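/- FOLTL≠-satisfiability is undecidable both in decreasing domain models and in constant domain models over ⟨ℚ,<⟩, and likewise both in decreasing domain models and in constant domain models over ⟨ℝ,<⟩. -/

import Mathlib

namespace HK

/-! ## Bimodal formulas -/

/-- Bimodal formulas: `φ ::= P | ¬φ | φ∧ψ | ◇₀φ | ◇₁φ`. -/
inductive BForm : Type
  | var : ℕ → BForm
  | neg : BForm → BForm
  | and : BForm → BForm → BForm
  | dia0 : BForm → BForm
  | dia1 : BForm → BForm

namespace BForm

def imp (φ ψ : BForm) : BForm := neg (and φ (neg ψ))
def bot : BForm := and (var 0) (neg (var 0))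
def top : BForm := neg bot
def box0 (φ : BForm) : BForm := neg (dia0 (neg φ))
def box1 (φ : BForm) : BForm := neg (dia1 (neg φ))
/-- `□₀⁺φ := φ ∧ □₀φ` -/
def boxP0 (φ : BForm) : BForm := and φ (box0 φ)
/-- `□₁⁺φ := φ ∧ □₁φ` -/
def boxP1 (φ : BForm) : BForm := and φ (box1 φ)

/-- Modal nesting depth. -/
def depth : BForm → ℕ
  | var _ => 0
  | neg φ => depth φ
  | and φ ψ => max (depth φ) (depth ψ)
  | dia0 φ => depth φ + 1
  | dia1 φ => depth φ + 1

/-- The propositional variable `k` occurs in the formula. -/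
def Occurs (k : ℕ) : BForm → Prop
  | var n => k = n
  | neg φ => Occurs k φ
  | and φ ψ => Occurs k φ ∨ Occurs k ψ
  | dia0 φ => Occurs k φ
  | dia1 φ => Occurs k φ

/-- The formula uses only the modal operator `◇₀`. -/
def OnlyDia0 : BForm → Prop
  | var _ => True
  | neg φ => OnlyDia0 φ
  | and φ ψ => OnlyDia0 φ ∧ OnlyDia0 ψ
  | dia0 φ => OnlyDia0 φ
  | dia1 _ => False

/-- The formula uses only the modal operator `◇₁`. -/
def OnlyDia1 : BForm → Prop
  | var _ => True
  | neg φ => OnlyDia1 φ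
  | and φ ψ => OnlyDia1 φ ∧ OnlyDia1 ψ
  | dia0 _ => False
  | dia1 φ => OnlyDia1 φ

/-- Relativisation `φ^D` of each diamond to the variable `d`:
each subformula `◇ᵢψ` is replaced by `◇ᵢ(D ∧ ψ^D)`. -/
def relativize (d : ℕ) : BForm → BForm
  | var n => var n
  | neg φ => neg (relativize d φ)
  | and φ ψ => and (relativize d φ) (relativize d ψ)
  | dia0 φ => dia0 (and (var d) (relativize d φ))
  | dia1 φ => dia1 (and (var d) (relativize d φ))

/-- `□₀^k φ` -/
def iterBox0 : ℕ → BForm → BForm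
  | 0, φ => φ
  | n+1, φ => box0 (iterBox0 n φ)

/-- `□₁^k φ` -/
def iterBox1 : ℕ → BForm → BForm
  | 0, φ => φ
  | n+1, φ => box1 (iterBox1 n φ)

/-- `□₀^{≤n} φ := ⋀_{k ≤ n} □₀^k φ` -/
def boxLe0 : ℕ → BForm → BForm
  | 0, φ => φ
  | n+1, φ => and (boxLe0 n φ) (iterBox0 (n+1) φ)

/-- `□₁^{≤n} φ := ⋀_{k ≤ n} □₁^k φ` -/
def boxLe1 : ℕ → BForm → BForm
  | 0, φ => φ
  | n+1, φ => and (boxLe1 n φ) (iterBox1 (n+1) φ)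

/-- Uniform substitution. -/
def subst (s : ℕ → BForm) : BForm → BForm
  | var n => s n
  | neg φ => neg (subst s φ)
  | and φ ψ => and (subst s φ) (subst s ψ)
  | dia0 φ => dia0 (subst s φ)
  | dia1 φ => dia1 (subst s φ)

end BForm

/-- Kripke truth over a 2-frame `⟨W, R0, R1⟩` with valuation `val`. -/
def BSat {W : Type} (R0 R1 : W → W → Prop) (val : ℕ → W → Prop) : W → BForm → Prop
  | w, .var n => val n w
  | w, .neg φ => ¬ BSat R0 R1 val w φ
  | w, .and φ ψ => BSat R0 R1 val w φ ∧ BSat R0 R1 val w ψ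
  | w, .dia0 φ => ∃ v, R0 w v ∧ BSat R0 R1 val v φ
  | w, .dia1 φ => ∃ v, R1 w v ∧ BSat R0 R1 val v φ

/-! ## Frames -/

/-- A (unimodal) frame: a nonempty set with a binary relation. -/
structure Frame : Type 1 where
  W : Type
  R : W → W → Prop
  ne : Nonempty W

/-- A 2-frame: a nonempty set with two binary relations. -/
structure Frame2 : Type 1 where
  W : Type
  R0 : W → W → Prop
  R1 : W → W → Prop
  ne : Nonempty W

/-- Validity of a bimodal formula in a 2-frame. -/
def Frame2.Valid (F : Frame2) (φ : BForm) : Prop :=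
  ∀ (val : ℕ → F.W → Prop) (w : F.W), BSat F.R0 F.R1 val w φ

/-- Satisfaction of a bimodal formula in some model based on the 2-frame. -/
def Frame2.Sat (F : Frame2) (φ : BForm) : Prop :=
  ∃ (val : ℕ → F.W → Prop) (w : F.W), BSat F.R0 F.R1 val w φ

/-- Horizontal relation of a product frame. -/
def prodR0 {A B : Type} (R : A → A → Prop) : A × B → A × B → Prop :=
  fun p q => R p.1 q.1 ∧ p.2 = q.2

/-- Vertical relation of a product frame. -/
def prodR1 {A B : Type} (S : B → B → Prop) : A × B → A × B → Prop :=
  fun p q => p.1 = q.1 ∧ S p.2 q.2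

/-- `φ` is satisfied in some model based on the product frame `⟨A,R⟩ × ⟨B,S⟩`. -/
def ProdSat {A B : Type} (R : A → A → Prop) (S : B → B → Prop) (φ : BForm) : Prop :=
  ∃ (val : ℕ → A × B → Prop) (w : A × B), BSat (prodR0 R) (prodR1 S) val w φ

/-- `φ` is valid in the product frame `⟨A,R⟩ × ⟨B,S⟩`. -/
def ProdValid {A B : Type} (R : A → A → Prop) (S : B → B → Prop) (φ : BForm) : Prop :=
  ∀ (val : ℕ → A × B → Prop) (w : A × B), BSat (prodR0 R) (prodR1 S) val w φ

/-- The product 2-frame of two frames. -/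
def prodFrame2 (A B : Type) [Nonempty A] [Nonempty B]
    (R : A → A → Prop) (S : B → B → Prop) : Frame2 :=
  ⟨A × B, prodR0 R, prodR1 S, inferInstance⟩

/-- Linear order: irreflexive, transitive and trichotomous. -/
def IsLin {T : Type} (R : T → T → Prop) : Prop :=
  (∀ x, ¬ R x x) ∧ (∀ x y z, R x y → R y z → R x z) ∧ (∀ x y, R x y ∨ x = y ∨ R y x)

/-- Weak order: transitive and weakly connected. -/
def WeakOrd {T : Type} (R : T → T → Prop) : Prop :=
  (∀ x y z, R x y → R y z → R x z) ∧ (∀ x y z, R x y → R x z → y = z ∨ R y z ∨ R z y)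

/-- Modal discreteness. -/
def ModallyDiscrete {T : Type} (R : T → T → Prop) : Prop :=
  ¬ ∃ (x : ℕ → T) (xω : T), (∀ i, R (x i) (x (i+1))) ∧ (∀ i, x i ≠ x (i+1)) ∧
      (∀ i, R (x i) xω) ∧ (∀ i, ¬ R xω (x i))

/-- No infinite ascending chains of distinct points. -/
def Noetherian {T : Type} (R : T → T → Prop) : Prop :=
  ¬ ∃ x : ℕ → T, (∀ i, R (x i) (x (i+1))) ∧ (∀ i, x i ≠ x (i+1))

/-- The frame is (isomorphic to) `⟨ω,<⟩`. -/
def IsOmegaFrame (F : Frame) : Prop :=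
  ∃ e : F.W ≃ ℕ, ∀ a b, F.R a b ↔ e a < e b

/-- The frame is a finite linear order. -/
def IsFinLinFrame (F : Frame) : Prop := Finite F.W ∧ IsLin F.R

/-- `F` contains an `⟨ω+1,>⟩`-type chain: distinct points `x₀,…,x_n,…,x_ω` with
`x_n R x_m` iff `n > m` (for `n ≠ m`). -/
def HasOmegaPlusOneChain (F : Frame) : Prop :=
  ∃ (x : ℕ → F.W) (xω : F.W), Function.Injective x ∧ (∀ n, x n ≠ xω) ∧
    (∀ n m, n ≠ m → (F.R (x n) (x m) ↔ m < n)) ∧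
    (∀ n, F.R xω (x n)) ∧ (∀ n, ¬ F.R (x n) xω)

/-! ## Two-dimensional (expanding/decreasing) 2-frames `H_{F,Ḡ}` -/

/-- A 2-frame `H_{F,Ḡ}` built from a horizontal frame `⟨H,R⟩` and, for each `x : H`,
a vertical frame `G_x = ⟨D x, S x⟩` carved out of a common ambient type `V`. -/
structure TwoFrame : Type 1 where
  H : Type
  R : H → H → Prop
  Hne : Nonempty H
  V : Type
  D : H → Set V
  S : H → V → V → Prop
  Dne : ∀ x, (D x).Nonempty

namespace TwoFrame

/-- The horizontal frame. -/
def horiz (T : TwoFrame) : Frame := ⟨T.H, T.R, T.Hne⟩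

/-- The vertical frame `G_x` at `x`. -/
def fiber (T : TwoFrame) (x : T.H) : Frame :=
  ⟨{a : T.V // a ∈ T.D x}, fun a b => T.S x a.1 b.1,
    Exists.elim (T.Dne x) (fun a ha => ⟨⟨a, ha⟩⟩)⟩

/-- The worlds `{⟨u,v⟩ : u ∈ H, v ∈ D u}`. -/
def Worlds (T : TwoFrame) : Type := {p : T.H × T.V // p.2 ∈ T.D p.1}

/-- Horizontal relation of `H_{F,Ḡ}`. -/
def Rh (T : TwoFrame) : T.Worlds → T.Worlds → Prop :=
  fun p q => T.R p.1.1 q.1.1 ∧ p.1.2 = q.1.2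

/-- Vertical relation of `H_{F,Ḡ}`. -/
def Rv (T : TwoFrame) : T.Worlds → T.Worlds → Prop :=
  fun p q => p.1.1 = q.1.1 ∧ T.S p.1.1 p.1.2 q.1.2

/-- `φ` is satisfied in some model based on `H_{F,Ḡ}`. -/
def Sat (T : TwoFrame) (φ : BForm) : Prop :=
  ∃ (val : ℕ → T.Worlds → Prop) (w : T.Worlds), BSat T.Rh T.Rv val w φ

/-- Decreasing 2-frame: `G_y` is a subframe of `G_x` whenever `x R y`. -/
def Decreasing (T : TwoFrame) : Prop :=
  ∀ x y, T.R x y → T.D y ⊆ T.D x ∧ ∀ a ∈ T.D y, ∀ b ∈ T.D y, (T.S y a b ↔ T.S x a b)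

/-- Expanding 2-frame: `G_x` is a subframe of `G_y` whenever `x R y`. -/
def Expanding (T : TwoFrame) : Prop :=
  ∀ x y, T.R x y → T.D x ⊆ T.D y ∧ ∀ a ∈ T.D x, ∀ b ∈ T.D x, (T.S x a b ↔ T.S y a b)

/-- All vertical frames are difference frames. -/
def DiffFibers (T : TwoFrame) : Prop :=
  ∀ x, ∀ a ∈ T.D x, ∀ b ∈ T.D x, (T.S x a b ↔ a ≠ b)

end TwoFrame

/-- `φ` is satisfied in some model based on a product of a member of `C`
with a difference frame. -/
def ProdDiffSat (C : Frame → Prop) (φ : BForm) : Prop :=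
  ∃ F : Frame, C F ∧ ∃ D : Type, Nonempty D ∧ ProdSat F.R (fun a b : D => a ≠ b) φ

/-- `φ` is satisfied in some model based on a decreasing 2-frame with horizontal
frame in `C` and all vertical frames difference frames. -/
def DecDiffSat (C : Frame → Prop) (φ : BForm) : Prop :=
  ∃ T : TwoFrame, C T.horiz ∧ T.Decreasing ∧ T.DiffFibers ∧ T.Sat φ

/-- `φ` is satisfied in some model based on an expanding 2-frame with horizontal
frame in `C` and all vertical frames difference frames. -/
def ExpDiffSat (C : Frame → Prop) (φ : BForm) : Prop :=
  ∃ T : TwoFrame, C T.horiz ∧ T.Expanding ∧ T.DiffFibers ∧ T.Sat φ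

/-- `φ` is satisfied in some model based on a product of a member of `C0` with a
member of `C1`. -/
def ProdClassSat (C0 C1 : Frame → Prop) (φ : BForm) : Prop :=
  ∃ F0, C0 F0 ∧ ∃ F1, C1 F1 ∧ ProdSat F0.R F1.R φ

/-- `φ` is satisfied in some model based on a decreasing 2-frame with horizontal
frame in `C0` and all vertical frames in `C1`. -/
def DecClassSat (C0 C1 : Frame → Prop) (φ : BForm) : Prop :=
  ∃ T : TwoFrame, C0 T.horiz ∧ (∀ x, C1 (T.fiber x)) ∧ T.Decreasing ∧ T.Sat φ

/-- `φ` is satisfied in some model based on an expanding 2-frame with horizontal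
frame in `C0` and all vertical frames in `C1`. -/
def ExpClassSat (C0 C1 : Frame → Prop) (φ : BForm) : Prop :=
  ∃ T : TwoFrame, C0 T.horiz ∧ (∀ x, C1 (T.fiber x)) ∧ T.Expanding ∧ T.Sat φ

/-- Satisfiability over products of `⟨ω,<⟩` with difference frames. -/
def OmegaDiffSat (φ : BForm) : Prop :=
  ∃ D : Type, Nonempty D ∧ ProdSat (fun m n : ℕ => m < n) (fun a b : D => a ≠ b) φ

/-- Satisfiability over products of finite linear orders with difference frames. -/
def FinLinDiffSat (φ : BForm) : Prop :=
  ∃ (T : Type) (R : T → T → Prop), Finite T ∧ IsLin R ∧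
    ∃ D : Type, Nonempty D ∧ ProdSat R (fun a b : D => a ≠ b) φ

/-! ## Bimodal logics -/

/-- Propositional tautology (diamond formulas treated as atoms). -/
def IsTaut (φ : BForm) : Prop :=
  ∀ v : BForm → Prop, (∀ ψ, v (BForm.neg ψ) ↔ ¬ v ψ) →
    (∀ ψ χ, v (BForm.and ψ χ) ↔ v ψ ∧ v χ) → v φ

/-- Normal bimodal logic. -/
structure IsLogic (L : Set BForm) : Prop where
  taut : ∀ φ, IsTaut φ → φ ∈ L
  K0 : BForm.imp (BForm.box0 (BForm.imp (BForm.var 0) (BForm.var 1)))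
        (BForm.imp (BForm.box0 (BForm.var 0)) (BForm.box0 (BForm.var 1))) ∈ L
  K1 : BForm.imp (BForm.box1 (BForm.imp (BForm.var 0) (BForm.var 1)))
        (BForm.imp (BForm.box1 (BForm.var 0)) (BForm.box1 (BForm.var 1))) ∈ L
  mp : ∀ φ ψ, BForm.imp φ ψ ∈ L → φ ∈ L → ψ ∈ L
  subst : ∀ φ s, φ ∈ L → BForm.subst s φ ∈ L
  nec0 : ∀ φ, φ ∈ L → BForm.box0 φ ∈ L
  nec1 : ∀ φ, φ ∈ L → BForm.box1 φ ∈ L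

/-- Validity of a (◇₀-)formula in a unimodal frame `⟨W,R⟩`. -/
def UValid0 {W : Type} (R : W → W → Prop) (φ : BForm) : Prop :=
  ∀ (val : ℕ → W → Prop) (w : W), BSat R (fun _ _ => False) val w φ

/-- Validity of a (◇₁-)formula in a unimodal frame `⟨W,S⟩`. -/
def UValid1 {W : Type} (S : W → W → Prop) (φ : BForm) : Prop :=
  ∀ (val : ℕ → W → Prop) (w : W), BSat (fun _ _ => False) S val w φ

/-- `K4.3`: the unimodal logic (in `◇₀`) of all linear orders. -/
def K43 : Set BForm :=
  {φ | φ.OnlyDia0 ∧ ∀ (T : Type) (R : T → T → Prop), Nonempty T → IsLin R → UValid0 R φ}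

/-- `Diff`: the unimodal logic (in `◇₁`) of all difference frames. -/
def DiffLogic : Set BForm :=
  {φ | φ.OnlyDia1 ∧ ∀ (D : Type), Nonempty D → UValid1 (fun a b : D => a ≠ b) φ}

/-- `Log⟨ω,<⟩`: the unimodal logic (in `◇₀`) of the frame `⟨ω,<⟩`. -/
def LogOmega : Set BForm :=
  {φ | φ.OnlyDia0 ∧ UValid0 (fun m n : ℕ => m < n) φ}

/-- `GL.3`: the unimodal logic (in `◇₀`) of all Noetherian irreflexive linear orders. -/
def GL3 : Set BForm :=
  {φ | φ.OnlyDia0 ∧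
    ∀ (T : Type) (R : T → T → Prop), Nonempty T → IsLin R → Noetherian R → UValid0 R φ}

/-- `DisK4.3`: the unimodal logic (in `◇₀`) of all modally discrete weak orders. -/
def DisK43 : Set BForm :=
  {φ | φ.OnlyDia0 ∧
    ∀ (T : Type) (R : T → T → Prop), Nonempty T → WeakOrd R → ModallyDiscrete R → UValid0 R φ}

def commAx1 : BForm :=
  BForm.imp (BForm.box1 (BForm.box0 (BForm.var 0))) (BForm.box0 (BForm.box1 (BForm.var 0)))
def commAx2 : BForm :=
  BForm.imp (BForm.box0 (BForm.box1 (BForm.var 0))) (BForm.box1 (BForm.box0 (BForm.var 0)))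
def commAx3 : BForm :=
  BForm.imp (BForm.dia0 (BForm.box1 (BForm.var 0))) (BForm.box1 (BForm.dia0 (BForm.var 0)))

/-- The commutator `[L0,L1]`: the smallest bimodal logic containing `L0`, `L1` (and
hence their fusion) together with the commutativity/confluence axioms. -/
def Commutator (L0 L1 : Set BForm) : Set BForm :=
  ⋂₀ {L : Set BForm | IsLogic L ∧ L0 ⊆ L ∧ L1 ⊆ L ∧
      commAx1 ∈ L ∧ commAx2 ∈ L ∧ commAx3 ∈ L}

/-- The product logic `L0 × L1`: the logic of all products of a frame for `L0`
with a frame for `L1`. -/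
def ProdLogic (L0 L1 : Set BForm) : Set BForm :=
  {φ | ∀ (A B : Type), Nonempty A → Nonempty B → ∀ (R : A → A → Prop) (S : B → B → Prop),
      (∀ ψ ∈ L0, UValid0 R ψ) → (∀ ψ ∈ L1, UValid1 S ψ) → ProdValid R S φ}

/-- The logic of a class of 2-frames. -/
def LogOf (C : Frame2 → Prop) : Set BForm := {φ | ∀ F, C F → F.Valid φ}

/-- Kripke completeness of a bimodal logic. -/
def KripkeComplete (L : Set BForm) : Prop := ∃ C : Frame2 → Prop, L = LogOf C

/-- `L`-satisfiability: `φ` is satisfied in some model `M` with `M ⊨ L`. -/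
def LSat (L : Set BForm) (φ : BForm) : Prop :=
  ∃ (W : Type) (_ : Nonempty W) (R0 R1 : W → W → Prop) (val : ℕ → W → Prop),
    (∀ ψ ∈ L, ∀ w, BSat R0 R1 val w ψ) ∧ ∃ w, BSat R0 R1 val w φ

/-! ## One-variable first-order temporal logic with counting (FOLTL≠) -/

/-- FOLTL≠-formulas: `φ ::= P(x) | ¬φ | φ∧ψ | ◇_F φ | ∃≠x φ`. -/
inductive TForm : Type
  | atom : ℕ → TForm
  | neg : TForm → TForm
  | and : TForm → TForm → TForm
  | diaF : TForm → TForm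
  | exNe : TForm → TForm

/-- Truth of an FOLTL≠-formula in a first-order temporal model based on the
timeline `⟨T,lt⟩` with domains `D` and interpretation `I`. -/
def TSat {T U : Type} (lt : T → T → Prop) (D : T → Set U) (I : ℕ → T → U → Prop) :
    T → U → TForm → Prop
  | t, a, .atom n => I n t a
  | t, a, .neg φ => ¬ TSat lt D I t a φ
  | t, a, .and φ ψ => TSat lt D I t a φ ∧ TSat lt D I t a ψ
  | t, a, .diaF φ => ∃ t', lt t t' ∧ a ∈ D t' ∧ TSat lt D I t' a φ
  | t, a, .exNe φ => ∃ b, b ∈ D t ∧ b ≠ a ∧ TSat lt D I t b φ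

/-- The standard translation `⋆` from FOLTL≠-formulas to bimodal formulas. -/
def TForm.star : TForm → BForm
  | .atom n => .var n
  | .neg φ => .neg (TForm.star φ)
  | .and φ ψ => .and (TForm.star φ) (TForm.star ψ)
  | .diaF φ => .dia0 (TForm.star φ)
  | .exNe φ => .dia1 (TForm.star φ)

/-- Satisfiability in constant domain models over the timeline `⟨T,lt⟩`. -/
def FOLTLConstSat {T : Type} (lt : T → T → Prop) (φ : TForm) : Prop :=
  ∃ (U : Type) (I : ℕ → T → U → Prop) (t : T) (a : U),
    TSat lt (fun _ => (Set.univ : Set U)) I t a φ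

/-- Satisfiability in decreasing domain models over the timeline `⟨T,lt⟩`. -/
def FOLTLDecSat {T : Type} (lt : T → T → Prop) (φ : TForm) : Prop :=
  ∃ (U : Type) (D : T → Set U), (∀ t, (D t).Nonempty) ∧
    (∀ t t', lt t t' → D t' ⊆ D t) ∧
    ∃ (I : ℕ → T → U → Prop) (t : T) (a : U), a ∈ D t ∧ TSat lt D I t a φ

/-- Satisfiability in expanding domain models over the timeline `⟨T,lt⟩`. -/
def FOLTLExpSat {T : Type} (lt : T → T → Prop) (φ : TForm) : Prop :=
  ∃ (U : Type) (D : T → Set U), (∀ t, (D t).Nonempty) ∧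
    (∀ t t', lt t t' → D t ⊆ D t') ∧
    ∃ (I : ℕ → T → U → Prop) (t : T) (a : U), a ∈ D t ∧ TSat lt D I t a φ

/-- Satisfiability in constant domain models over a class `C` of timelines. -/
def FOLTLConstSatC (C : Frame → Prop) (φ : TForm) : Prop :=
  ∃ F, C F ∧ FOLTLConstSat F.R φ

/-- Satisfiability in decreasing domain models over a class `C` of timelines. -/
def FOLTLDecSatC (C : Frame → Prop) (φ : TForm) : Prop :=
  ∃ F, C F ∧ FOLTLDecSat F.R φ

/-- Satisfiability in expanding domain models over a class `C` of timelines. -/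
def FOLTLExpSatC (C : Frame → Prop) (φ : TForm) : Prop :=
  ∃ F, C F ∧ FOLTLExpSat F.R φ

/-- The class of all linear orders. -/
def AllLin : Frame → Prop := fun F => IsLin F.R

/-- The class of all finite linear orders. -/
def AllFinLin : Frame → Prop := IsFinLinFrame

/-! ## Gödel numbering -/

/-- A fixed effective Gödel numbering of bimodal formulas. -/
def encodeB : BForm → ℕ
  | .var n => Nat.pair 0 n
  | .neg φ => Nat.pair 1 (encodeB φ)
  | .and φ ψ => Nat.pair 2 (Nat.pair (encodeB φ) (encodeB ψ))
  | .dia0 φ => Nat.pair 3 (encodeB φ)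
  | .dia1 φ => Nat.pair 4 (encodeB φ)

/-- A fixed effective Gödel numbering of FOLTL≠-formulas. -/
def encodeT : TForm → ℕ
  | .atom n => Nat.pair 0 n
  | .neg φ => Nat.pair 1 (encodeT φ)
  | .and φ ψ => Nat.pair 2 (Nat.pair (encodeT φ) (encodeT ψ))
  | .diaF φ => Nat.pair 3 (encodeT φ)
  | .exNe φ => Nat.pair 4 (encodeT φ)

/-- The set of codes of bimodal formulas with property `P`. -/
def BCodes (P : BForm → Prop) : ℕ → Prop := fun n => ∃ φ, encodeB φ = n ∧ P φ

/-- The set of codes of FOLTL≠-formulas with property `P`. -/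
def TCodes (P : TForm → Prop) : ℕ → Prop := fun n => ∃ φ, encodeT φ = n ∧ P φ

/-! ## The analytical hierarchy: Σ₁¹ -/

/-- `A ⊆ ℕ` is `Σ₁¹`: in normal form `n ∈ A ↔ ∃ f : ℕ → ℕ, ∀ m, R (n, f̄(m))`
for a computable predicate `R` of the number `n` and finite initial segments of `f`. -/
def Sigma11 (A : ℕ → Prop) : Prop :=
  ∃ R : ℕ × List ℕ → Prop, ComputablePred R ∧
    ∀ n, A n ↔ ∃ f : ℕ → ℕ, ∀ m, R (n, (List.range m).map f)

/-- `Σ₁¹`-hardness with respect to computable many-one reducibility. -/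
def Sigma11Hard (A : ℕ → Prop) : Prop := ∀ B : ℕ → Prop, Sigma11 B → ManyOneReducible B A

/-- `Σ₁¹`-completeness. -/
def Sigma11Complete (A : ℕ → Prop) : Prop := Sigma11 A ∧ Sigma11Hard A

/-! ## Counter (Minsky) machines -/

/-- Counter machine operations: `inl i` increments counter `i`, `inr (inl i)`
decrements counter `i`, `inr (inr i)` zero-tests counter `i`. -/
abbrev CMOp : Type := ℕ ⊕ ℕ ⊕ ℕ

def CMOp.counter : CMOp → ℕ
  | Sum.inl i => i
  | Sum.inr (Sum.inl i) => i
  | Sum.inr (Sum.inr i) => i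

/-- Description of a counter machine: number `N` of counters, number of states
(states are `0,…,states-1`), list of terminal states, and list of instructions
`(q, op, q')`. -/
abbrev CMDesc : Type := ℕ × ℕ × List ℕ × List (ℕ × CMOp × ℕ)

/-- Well-formedness of a counter machine description: `N > 1`, terminal states are
states, instructions are attached to non-terminal states and mention genuine
counters, and every non-terminal state has at least one instruction. -/
def CMWF (M : CMDesc) : Prop :=
  1 < M.1 ∧ (∀ q ∈ M.2.2.1, q < M.2.1) ∧
  (∀ t ∈ M.2.2.2, t.1 < M.2.1 ∧ t.1 ∉ M.2.2.1 ∧ t.2.2 < M.2.1 ∧ CMOp.counter t.2.1 < M.1) ∧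
  (∀ q, q < M.2.1 → q ∉ M.2.2.1 → ∃ t ∈ M.2.2.2, t.1 = q)

/-- A configuration: current state and contents of the counters. -/
abbrev CMConfig : Type := ℕ × (ℕ → ℕ)

/-- Reliable step of a counter machine. -/
def CMStep (M : CMDesc) (σ σ' : CMConfig) : Prop :=
  ∃ op q', (σ.1, op, q') ∈ M.2.2.2 ∧ σ'.1 = q' ∧
    match op with
    | Sum.inl i => σ'.2 i = σ.2 i + 1 ∧ ∀ j, j ≠ i → σ'.2 j = σ.2 j
    | Sum.inr (Sum.inl i) => 0 < σ.2 i ∧ σ'.2 i + 1 = σ.2 i ∧ ∀ j, j ≠ i → σ'.2 j = σ.2 j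
    | Sum.inr (Sum.inr i) => σ.2 i = 0 ∧ ∀ j, σ'.2 j = σ.2 j

/-- Lossy step of a counter machine. -/
def CMStepLossy (M : CMDesc) (σ σ' : CMConfig) : Prop :=
  ∃ c1 c2 : ℕ → ℕ, CMStep M (σ.1, c1) (σ'.1, c2) ∧ (∀ i, c1 i ≤ σ.2 i) ∧ (∀ i, σ'.2 i ≤ c2 i)

/-- The configuration `⟨q, 𝟎⟩` with all-0 counters. -/
def zeroConfig (q : ℕ) : CMConfig := (q, fun _ => 0)

/-- CM non-termination: the machine has an infinite run starting with `⟨q₀,𝟎⟩`. -/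
def CMNonTerm : CMDesc × ℕ → Prop := fun p =>
  CMWF p.1 ∧ ∃ ρ : ℕ → CMConfig, ρ 0 = zeroConfig p.2 ∧ ∀ n, CMStep p.1 (ρ n) (ρ (n+1))

/-- CM reachability: the machine has a run starting with `⟨q₀,𝟎⟩` reaching `q_r`. -/
def CMReach : CMDesc × ℕ × ℕ → Prop := fun p =>
  CMWF p.1 ∧ ∃ (B : ℕ) (ρ : ℕ → CMConfig), ρ 0 = zeroConfig p.2.1 ∧
    (∀ n, n < B → CMStep p.1 (ρ n) (ρ (n+1))) ∧ (ρ B).1 = p.2.2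

/-- CM recurrence: the machine has an infinite run starting with `⟨q₀,𝟎⟩`
visiting `q_r` infinitely often. -/
def CMRecur : CMDesc × ℕ × ℕ → Prop := fun p =>
  CMWF p.1 ∧ ∃ ρ : ℕ → CMConfig, ρ 0 = zeroConfig p.2.1 ∧
    (∀ n, CMStep p.1 (ρ n) (ρ (n+1))) ∧ ∀ n, ∃ m, n ≤ m ∧ (ρ m).1 = p.2.2

/-- LCM reachability: the machine has a lossy run starting with `⟨q₀,𝟎⟩`
reaching `q_r`. -/
def LCMReach : CMDesc × ℕ × ℕ → Prop := fun p =>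
  CMWF p.1 ∧ ∃ (B : ℕ) (ρ : ℕ → CMConfig), ρ 0 = zeroConfig p.2.1 ∧
    (∀ n, n < B → CMStepLossy p.1 (ρ n) (ρ (n+1))) ∧ (ρ B).1 = p.2.2

/-- LCM ω-reachability: for every `k`, the machine has a lossy run starting with
`⟨q₀,𝟎⟩` visiting `q_r` at least `k` times. -/
def LCMOmegaReach : CMDesc × ℕ × ℕ → Prop := fun p =>
  CMWF p.1 ∧ ∀ k : ℕ, ∃ (B : ℕ) (ρ : ℕ → CMConfig), ρ 0 = zeroConfig p.2.1 ∧
    (∀ n, n < B → CMStepLossy p.1 (ρ n) (ρ (n+1))) ∧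
    k ≤ ((Finset.range (B+1)).filter (fun n => (ρ n).1 = p.2.2)).card

/-! ## Particular formulas used in the statements -/

/-- `□₁⁺□₀⁺(◇₀⊤ → □₁◇₀⊤) ∧ φ` (Prop. 2.4 of the paper). -/
def diffDecForm (φ : BForm) : BForm :=
  BForm.and
    (BForm.boxP1 (BForm.boxP0
      (BForm.imp (BForm.dia0 BForm.top) (BForm.box1 (BForm.dia0 BForm.top))))) φ

/-- `D ∧ □₀^{≤n}□₁^{≤n}(◇₀D → D) ∧ φ^D`. -/
def decRelForm (d n : ℕ) (φ : BForm) : BForm :=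
  BForm.and (BForm.var d)
    (BForm.and
      (BForm.boxLe0 n (BForm.boxLe1 n
        (BForm.imp (BForm.dia0 (BForm.var d)) (BForm.var d))))
      (BForm.relativize d φ))

/-- `D ∧ □₀^{≤n}□₁^{≤n}(D → □₀D) ∧ φ^D`. -/
def expRelForm (d n : ℕ) (φ : BForm) : BForm :=
  BForm.and (BForm.var d)
    (BForm.and
      (BForm.boxLe0 n (BForm.boxLe1 n
        (BForm.imp (BForm.var d) (BForm.box0 (BForm.var d)))))
      (BForm.relativize d φ))

/-! ## Counter machines and loop programs -/

/-- Instructions of a counter machine with state set `σ`. -/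
inductive Ins (σ : Type) : Type
  | halt : Ins σ
  | inc : ℕ → σ → Ins σ
  | jz : ℕ → σ → σ → Ins σ
  | jmp : σ → Ins σ

/-- One step of a counter machine. -/
def mstep {σ : Type} (ins : σ → Ins σ) (c : σ × (ℕ → ℕ)) : Option (σ × (ℕ → ℕ)) :=
  match ins c.1 with
  | .halt => none
  | .inc r s => some (s, Function.update c.2 r (c.2 r + 1))
  | .jz r s1 s2 => if c.2 r = 0 then some (s1, c.2) else
      some (s2, Function.update c.2 r (c.2 r - 1))
  | .jmp s => some (s, c.2)

/-- Structured programs. `loop r p` repeats `r := r - 1; p` while `r > 0`. -/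
inductive Prog : Type
  | nop : Prog
  | inc : ℕ → Prog
  | seq : Prog → Prog → Prog
  | loop : ℕ → Prog → Prog

namespace Prog

/-- Injective coding of programs. -/
def code : Prog → ℕ
  | nop => Nat.pair 0 0
  | inc r => Nat.pair 1 r
  | seq p q => Nat.pair 2 (Nat.pair p.code q.code)
  | loop r p => Nat.pair 3 (Nat.pair r p.code)

theorem code_inj : ∀ p q : Prog, p.code = q.code → p = q := by
  intro p
  induction p with
  | nop => intro q h; cases q <;> simp [code, Nat.pair_eq_pair] at h ⊢
  | inc r => intro q h; cases q <;> simp [code, Nat.pair_eq_pair] at h ⊢; exact h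
  | seq a b iha ihb =>
    intro q h; cases q <;> simp [code, Nat.pair_eq_pair] at h ⊢
    exact ⟨iha _ h.1, ihb _ h.2⟩
  | loop r a iha =>
    intro q h; cases q <;> simp [code, Nat.pair_eq_pair] at h ⊢
    exact ⟨h.1, iha _ h.2⟩

/-- Injective coding of control states. -/
def lcode (l : List Prog) : ℕ := Encodable.encode (l.map code)

theorem lcode_inj : Function.Injective lcode := by
  intro a b h
  have h1 := Encodable.encode_injective h
  exact (List.map_injective_iff.2 (fun p q => code_inj p q)) h1

/-- The machine whose control states are continuations. -/
def ins : List Prog → Ins (List Prog)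
  | [] => .halt
  | nop :: k => .jmp k
  | inc r :: k => .inc r k
  | seq p q :: k => .jmp (p :: q :: k)
  | loop r p :: k => .jz r k (p :: loop r p :: k)

/-- Reachable control states while running `p` with continuation `k`, without `k` itself. -/
def states : Prog → List Prog → List (List Prog)
  | nop, k => [nop :: k]
  | inc r, k => [inc r :: k]
  | seq p q, k => (seq p q :: k) :: (states p (q :: k) ++ states q k)
  | loop r p, k => (loop r p :: k) :: states p (loop r p :: k)

/-- A bound for the registers. -/
def bound : Prog → ℕ
  | nop => 0
  | inc r => r + 1
  | seq p q => max p.bound q.bound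
  | loop r p => max (r + 1) p.bound

end Prog

/-- The instruction only uses registers below `m` and targets in `L`. -/
def InsOk {σ : Type} (L : List σ) (m : ℕ) : Ins σ → Prop
  | .halt => True
  | .inc r s => r < m ∧ s ∈ L
  | .jz r s1 s2 => r < m ∧ s1 ∈ L ∧ s2 ∈ L
  | .jmp s => s ∈ L

theorem InsOk.mono {σ : Type} {L L' : List σ} {m m' : ℕ} (hL : L ⊆ L') (hm : m ≤ m')
    {i : Ins σ} (h : InsOk L m i) : InsOk L' m' i := by
  cases i <;> simp only [InsOk] at h ⊢
  · exact ⟨by omega, hL h.2⟩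
  · exact ⟨by omega, hL h.2.1, hL h.2.2⟩
  · exact hL h

theorem Prog.mem_states (p : Prog) (k : List Prog) : p :: k ∈ p.states k := by
  cases p <;> simp [Prog.states]

theorem Prog.states_ok (p : Prog) : ∀ (k : List Prog), ∀ s ∈ p.states k,
    InsOk (k :: p.states k) p.bound (Prog.ins s) := by
  induction p with
  | nop => intro k s hs; simp [states] at hs; subst hs; simp [ins, InsOk]
  | inc r => intro k s hs; simp [states] at hs; subst hs; simp [ins, InsOk, bound]
  | seq p q ihp ihq =>
    intro k s hs
    simp only [states, List.mem_cons, List.mem_append] at hs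
    have hp := mem_states p (q :: k)
    have hq := mem_states q k
    rcases hs with rfl | hs | hs
    · simp [ins, InsOk, states, hp]
    · refine (ihp _ s hs).mono ?_ (by simp [bound])
      intro x hx; simp [states] at hx ⊢; rcases hx with rfl | hx
      · simp [hq]
      · simp [hx]
    · refine (ihq _ s hs).mono ?_ (by simp [bound])
      intro x hx; simp [states] at hx ⊢; rcases hx with rfl | hx
      · simp
      · simp [hx]
  | loop r p ihp =>
    intro k s hs
    simp only [states, List.mem_cons] at hs
    have hp := mem_states p (loop r p :: k)
    rcases hs with rfl | hs
    · simp [ins, InsOk, states, hp, bound]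
    · refine (ihp _ s hs).mono ?_ (by simp [bound])
      intro x hx; simp [states] at hx ⊢; rcases hx with rfl | hx
      · simp
      · simp [hx]

/-- One-step relation of the program machine. -/
def PStep (c c' : List Prog × (ℕ → ℕ)) : Prop := mstep Prog.ins c = some c'

/-- `p` transforms the first store to the second. -/
def Ex (p : Prog) (s s' : ℕ → ℕ) : Prop :=
  ∀ k, Relation.ReflTransGen PStep (p :: k, s) (k, s')

theorem ex_nop (s : ℕ → ℕ) : Ex .nop s s := fun _ =>
  Relation.ReflTransGen.single (by simp [PStep, mstep, Prog.ins])

theorem ex_inc (r : ℕ) (s : ℕ → ℕ) : Ex (.inc r) s (Function.update s r (s r + 1)) := fun _ =>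
  Relation.ReflTransGen.single (by simp [PStep, mstep, Prog.ins])

theorem ex_seq {p q : Prog} {s s' s'' : ℕ → ℕ} (h : Ex p s s') (h' : Ex q s' s'') :
    Ex (.seq p q) s s'' := fun k =>
  Relation.ReflTransGen.head (b := (p :: q :: k, s)) (by simp [PStep, mstep, Prog.ins])
    ((h _).trans (h' _))

theorem ex_loop_zero {r : ℕ} {p : Prog} {s : ℕ → ℕ} (h : s r = 0) : Ex (.loop r p) s s := fun _ =>
  Relation.ReflTransGen.single (by simp [PStep, mstep, Prog.ins, h])

theorem pstep_loop_succ {r : ℕ} {p : Prog} {s : ℕ → ℕ} (h : s r ≠ 0) (k : List Prog) :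
    PStep (.loop r p :: k, s) (p :: .loop r p :: k, Function.update s r (s r - 1)) := by
  simp [PStep, mstep, Prog.ins, h]

theorem ex_loop_succ {r : ℕ} {p : Prog} {s s' s'' : ℕ → ℕ} (h : s r ≠ 0)
    (h1 : Ex p (Function.update s r (s r - 1)) s') (h2 : Ex (.loop r p) s' s'') :
    Ex (.loop r p) s s'' := fun k =>
  Relation.ReflTransGen.head (pstep_loop_succ h k) ((h1 _).trans (h2 _))

theorem ex_loop_iter {r : ℕ} {p : Prog} : ∀ (n : ℕ) (s : ℕ → ℕ → ℕ),
    (∀ i, i ≤ n → s i r = n - i) →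
    (∀ i, i < n → Ex p (Function.update (s i) r (n - i - 1)) (s (i + 1))) →
    Ex (.loop r p) (s 0) (s n) := by
  intro n
  induction n with
  | zero => intro s h _; exact ex_loop_zero (by simpa using h 0 le_rfl)
  | succ n ih =>
    intro s h h'
    have h0 := h 0 (by omega)
    refine ex_loop_succ (s' := s 1) (by omega) ?_ ?_
    · have := h' 0 (by omega)
      rw [h0]; exact this
    · refine ih (fun i => s (i + 1)) (fun i hi => ?_) (fun i hi => ?_)
      · rw [h (i + 1) (by omega)]; omega
      · have := h' (i + 1) (by omega)
        rwa [show n + 1 - (i + 1) - 1 = n - i - 1 by omega] at this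

theorem Ex.congr {p : Prog} {s s' t t' : ℕ → ℕ} (h : Ex p s s') (h1 : s = t) (h2 : s' = t') :
    Ex p t t' := h1 ▸ h2 ▸ h

theorem ex_clear (r : ℕ) (s : ℕ → ℕ) : Ex (.loop r .nop) s (Function.update s r 0) := by
  refine (ex_loop_iter (s r) (fun i => Function.update s r (s r - i)) ?_ ?_).congr ?_ ?_
  · intro i hi; simp
  · intro i hi
    refine (ex_nop _).congr rfl ?_
    simp; rfl
  · simp
  · simp

theorem ex_move {a o : ℕ} (hao : a ≠ o) (s : ℕ → ℕ) :
    Ex (.loop a (.inc o)) s (Function.update (Function.update s a 0) o (s o + s a)) := by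
  refine (ex_loop_iter (s a)
    (fun i => Function.update (Function.update s a (s a - i)) o (s o + i)) ?_ ?_).congr ?_ ?_
  · intro i hi; simp [Function.update, hao]
  · intro i hi
    refine (ex_inc _ _).congr rfl ?_
    funext x
    simp only [Function.update_apply]
    grind
  · funext x; simp only [Function.update_apply]; grind
  · simp

theorem ex_copy {a o t : ℕ} (hao : a ≠ o) (hat : a ≠ t) (hot : o ≠ t) (s : ℕ → ℕ) (ht : s t = 0) :
    Ex (.seq (.loop a (.seq (.inc o) (.inc t))) (.loop t (.inc a))) s
      (Function.update s o (s o + s a)) := by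
  refine ex_seq (s' := fun x => if x = a then 0 else if x = o then s o + s a else
      if x = t then s a else s x) ?_ ?_
  · refine (ex_loop_iter (s a) (fun i x => if x = a then s a - i else if x = o then s o + i else
      if x = t then i else s x) ?_ ?_).congr ?_ ?_
    · intro i hi; simp
    · intro i hi
      refine (ex_seq (ex_inc _ _) (ex_inc _ _)).congr rfl ?_
      funext x
      simp only [Function.update_apply]
      grind
    · funext x; grind
    · funext x; grind
  · refine (ex_move (Ne.symm hat) _).congr rfl ?_
    funext x
    simp only [Function.update_apply]
    grind

/-- `f` is computable by programs: for every register layout. -/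
def Computes {n : ℕ} (f : List.Vector ℕ n → ℕ) : Prop :=
  ∀ (a : Fin n → ℕ) (o b : ℕ), (∀ i, a i < b) → o < b → (∀ i, a i ≠ o) →
    ∃ p : Prog, ∀ s : ℕ → ℕ, (∀ x, b ≤ x → s x = 0) → s o = 0 →
      Ex p s (Function.update s o (f (List.Vector.ofFn fun i => s (a i))))

/-- Run a list of programs in sequence. -/
def seqList {n : ℕ} (g : Fin n → Prog) : Prog := (List.ofFn g).foldr .seq .nop

theorem ex_seqList : ∀ {n : ℕ} (g : Fin n → Prog) (s : ℕ → ℕ → ℕ),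
    (∀ i : Fin n, Ex (g i) (s i) (s (i + 1))) → Ex (seqList g) (s 0) (s n) := by
  intro n
  induction n with
  | zero => intro g s _; simpa [seqList] using ex_nop (s 0)
  | succ n ih =>
    intro g s h
    have h2 := ih (fun i => g i.succ) (fun i => s (i + 1)) (fun i => by simpa using h i.succ)
    have h1 : Ex (g 0) (s 0) (s 1) := by simpa using h 0
    have := ex_seq h1 h2
    simpa [seqList, List.ofFn_succ] using this

theorem computes_of_primrec {n : ℕ} {f : List.Vector ℕ n → ℕ} (hf : Nat.Primrec' f) :
    Computes f := by
  induction hf with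
  | zero =>
    intro a o b _ _ _
    refine ⟨.nop, fun s _ ho => (ex_nop s).congr rfl ?_⟩
    funext x
    simp only [Function.update_apply]
    split_ifs with h
    · rw [h, ho]
    · rfl
  | succ =>
    intro a o b ha hob hao
    refine ⟨.seq (.seq (.loop (a 0) (.seq (.inc o) (.inc b))) (.loop b (.inc (a 0)))) (.inc o),
      fun s hs ho => ?_⟩
    refine (ex_seq (ex_copy (hao 0) (ha 0).ne hob.ne s (hs b le_rfl)) (ex_inc _ _)).congr rfl ?_
    simp [ho]
  | get j =>
    intro a o b ha hob hao
    refine ⟨.seq (.loop (a j) (.seq (.inc o) (.inc b))) (.loop b (.inc (a j))),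
      fun s hs ho => ?_⟩
    refine (ex_copy (hao j) (ha j).ne hob.ne s (hs b le_rfl)).congr rfl ?_
    simp [ho]
  | @comp m n f g _ _ ihf ihg =>
    intro a o b ha hob hao
    have hg : ∀ i : Fin n, ∃ p : Prog, ∀ s : ℕ → ℕ, (∀ x, b + n ≤ x → s x = 0) → s (b + i) = 0 →
        Ex p s (Function.update s (b + i) (g i (List.Vector.ofFn fun j => s (a j)))) := fun i =>
      ihg i a (b + i) (b + n) (fun j => by have := ha j; omega) (by omega)
        (fun j => by have := ha j; omega)
    choose p hp using hg
    obtain ⟨q, hq⟩ := ihf (fun i : Fin n => b + i) o (b + n) (fun i => by omega) (by omega)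
      (fun i => by omega)
    refine ⟨.seq (seqList p) (.seq q (seqList fun i : Fin n => .loop (b + i) .nop)),
      fun s hs ho => ?_⟩
    have hsa : ∀ j, s (a j) = s (a j) := fun j => rfl
    let G : ℕ → ℕ := fun x => if h : x < n then g ⟨x, h⟩ (List.Vector.ofFn fun j => s (a j)) else 0
    have e1 : Ex (seqList p) s (fun x => if b ≤ x ∧ x < b + n then G (x - b) else s x) := by
      refine (ex_seqList p (fun i x => if b ≤ x ∧ x < b + i then G (x - b) else s x) ?_).congr ?_ rfl
      · intro i
        refine (hp i _ ?_ ?_).congr rfl ?_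
        · intro x hx; have := i.2; rw [if_neg (by omega)]; exact hs x (by omega)
        · rw [if_neg (by omega)]; exact hs _ (by omega)
        · funext x
          have hv : (List.Vector.ofFn fun j => if b ≤ a j ∧ a j < b + (i : ℕ) then G (a j - b)
              else s (a j)) = List.Vector.ofFn fun j => s (a j) := by
            congr 1; funext j; have := ha j; rw [if_neg (by omega)]
          rw [hv]
          have hG : g i (List.Vector.ofFn fun j => s (a j)) = G i := by simp [G]
          rw [hG]
          simp only [Function.update_apply]
          split_ifs with h1 h2 h3 h4 h5
          · subst h1; simp
          · omega
          · rfl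
          · omega
          · omega
          · rfl
      · funext x; rw [if_neg (by omega)]
    refine (ex_seq e1 (ex_seq (hq _ ?_ ?_) (ex_seqList _ (fun i x => if x = o then
      f (List.Vector.ofFn fun i => g i (List.Vector.ofFn fun i => s (a i))) else
      if b + i ≤ x ∧ x < b + n then G (x - b) else s x) ?_ |>.congr ?_ rfl))).congr rfl ?_
    · intro x hx; rw [if_neg (by omega)]; exact hs x (by omega)
    · rw [if_neg (by omega)]; exact ho
    · intro i
      refine (ex_clear _ _).congr rfl ?_
      funext x
      simp only [Function.update_apply]
      have := i.2
      have := hs x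
      split_ifs <;> first | rfl | omega
    · funext x
      simp only [Function.update_apply]
      have hv : (List.Vector.ofFn fun i : Fin n => if b ≤ b + (i : ℕ) ∧ b + (i : ℕ) < b + n then
          G (b + (i : ℕ) - b) else s (b + (i : ℕ))) =
          List.Vector.ofFn fun i => g i (List.Vector.ofFn fun j => s (a j)) := by
        congr 1; funext i; rw [if_pos (by omega)]; simp [G]
      rw [hv]
      simp
    · funext x
      simp only [Function.update_apply]
      split_ifs <;> first | rfl | omega
  | @prec n f g _ _ ihf ihg =>
    intro a o b ha hob hao
    -- registers: b = y, b+1 = acc, b+2 = loop counter, b+3 = new, b+4 = temp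
    obtain ⟨p, hp⟩ := ihf (fun i => a i.succ) (b + 1) (b + 5) (fun i => by have := ha i.succ; omega)
      (by omega) (fun i => by have := ha i.succ; omega)
    obtain ⟨q, hq⟩ := ihg (Fin.cons b (Fin.cons (b + 1) fun i => a i.succ)) (b + 3) (b + 5)
      (by
        intro i
        refine Fin.cases ?_ (fun i => ?_) i
        · simp
        · refine Fin.cases ?_ (fun i => ?_) i
          · simp
          · have := ha i.succ; simp; omega)
      (by omega)
      (by
        intro i
        refine Fin.cases ?_ (fun i => ?_) i
        · simp
        · refine Fin.cases ?_ (fun i => ?_) i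
          · simp
          · have := ha i.succ; simp; omega)
    refine ⟨.seq p (.seq (.seq (.loop (a 0) (.seq (.inc (b + 2)) (.inc (b + 4))))
      (.loop (b + 4) (.inc (a 0))))
      (.seq (.loop (b + 2) (.seq q (.seq (.loop (b + 1) .nop)
        (.seq (.loop (b + 3) (.inc (b + 1))) (.inc b)))))
        (.seq (.loop (b + 1) (.inc o)) (.loop b .nop)))), fun s hs ho => ?_⟩
    have ha0 := ha 0
    have hao0 := hao 0
    let v : List.Vector ℕ n := List.Vector.ofFn fun i => s (a i.succ)
    let F : ℕ → ℕ := fun k => Nat.rec (f v) (fun y IH => g (y ::ᵥ IH ::ᵥ v)) k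
    let N := s (a 0)
    have hb : ∀ j, s (b + j) = 0 := fun j => hs _ (by omega)
    let st : ℕ → ℕ → ℕ := fun i x => if x = b then i else if x = b + 1 then F i else
      if x = b + 2 then N - i else s x
    have e1 := hp s (fun x hx => hs x (by omega)) (hb 1)
    have e2 := ex_copy (a := a 0) (o := b + 2) (t := b + 4) (by omega) (by omega) (by omega)
      (Function.update s (b + 1) (f v))
      (by simp [Function.update_apply, hb])
    have e3 : Ex (.loop (b + 2) (.seq q (.seq (.loop (b + 1) .nop)
        (.seq (.loop (b + 3) (.inc (b + 1))) (.inc b))))) (st 0) (st N) := by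
      refine ex_loop_iter N st (fun i _ => by simp [st]) (fun i hi => ?_)
      have h1 := hq (Function.update (st i) (b + 2) (N - i - 1))
        (fun x hx => by
          have := hs x (by omega)
          simp only [Function.update_apply, st]
          split_ifs <;> omega)
        (by simp [Function.update_apply, st, hb])
      have hv : (List.Vector.ofFn fun j => Function.update (st i) (b + 2) (N - i - 1)
          ((Fin.cons b (Fin.cons (b + 1) fun i => a i.succ) : Fin (n + 2) → ℕ) j)) =
          i ::ᵥ F i ::ᵥ v := by
        have hx : ∀ j, Function.update (st i) (b + 2) (N - i - 1) (a (Fin.succ j)) =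
            s (a (Fin.succ j)) := by
          intro j
          have := ha (Fin.succ j)
          simp only [Function.update_apply, st]
          rw [if_neg (by omega), if_neg (by omega), if_neg (by omega), if_neg (by omega)]
        simp only [List.Vector.ofFn, Fin.cons_zero, Fin.cons_succ, hx, v]
        simp [st]
      rw [hv] at h1
      have hF : g (i ::ᵥ F i ::ᵥ v) = F (i + 1) := rfl
      rw [hF] at h1
      refine (ex_seq h1 (ex_seq (ex_clear _ _) (ex_seq (ex_move (by omega) _)
        (ex_inc _ _)))).congr rfl ?_
      funext x
      have := hb 3
      simp only [Function.update_apply, st]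
      split_ifs <;> first | rfl | omega | grind
    have e4 := ex_move (a := b + 1) (o := o) (by omega) (st N)
    refine (ex_seq e1 (ex_seq e2 (ex_seq (e3.congr ?_ rfl) (ex_seq e4 (ex_clear _ _))))).congr rfl ?_
    · funext x
      have := hb 0
      have := hb 2
      simp only [Function.update_apply, st]
      have hF : F 0 = f v := rfl
      rw [hF]
      split_ifs <;> first | rfl | omega | grind
    · have hF : F N = (List.Vector.ofFn fun i => s (a i)).head.rec
          (f (List.Vector.ofFn fun i => s (a i)).tail) (fun y IH =>
            g (y ::ᵥ IH ::ᵥ (List.Vector.ofFn fun i => s (a i)).tail)) := by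
        simp [List.Vector.ofFn, F, N, v]
      show _ = Function.update s o _
      beta_reduce
      rw [← hF]
      funext x
      have := hb 0
      have := hb 1
      have := hb 2
      simp only [Function.update_apply, st]
      split_ifs <;> first | rfl | omega | grind

/-- Halting of program configurations (as accessibility). -/
def PAcc (c : List Prog × (ℕ → ℕ)) : Prop := Acc (fun c' c => PStep c c') c

theorem pacc_of_step {c c' : List Prog × (ℕ → ℕ)} (h : PStep c c') (h' : PAcc c') : PAcc c := by
  refine Acc.intro _ fun d hd => ?_
  have : d = c' := by
    have := h.symm.trans hd
    exact (Option.some.inj this).symm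
  rw [this]; exact h'

theorem pacc_of_reach {c c' : List Prog × (ℕ → ℕ)} (h : Relation.ReflTransGen PStep c c')
    (h' : PAcc c') : PAcc c := by
  induction h using Relation.ReflTransGen.head_induction_on with
  | refl => exact h'
  | head h1 _ ih => exact pacc_of_step h1 ih

theorem pacc_nil (s : ℕ → ℕ) : PAcc ([], s) :=
  Acc.intro _ fun d hd => by simp [PStep, mstep, Prog.ins] at hd

theorem not_pacc_of_chain (C : ℕ → List Prog × (ℕ → ℕ))
    (h : ∀ k, Relation.TransGen PStep (C k) (C (k + 1))) : ¬ PAcc (C 0) := by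
  intro hacc
  have h2 := Acc.transGen hacc
  refine (not_acc_iff_exists_descending_chain.2 ⟨C, rfl, fun k => ?_⟩) h2
  have := (Relation.transGen_swap (r := PStep) (a := C (k + 1)) (b := C k)).2 (h k)
  exact this

/-- A fixed program searching for a witness. -/
theorem exists_search (t : ℕ → ℕ → ℕ) (ht : Primrec₂ t) :
    ∃ P : Prog, ∀ n, PAcc ([P], Function.update (fun _ => 0) 0 n) ↔ ∃ k, t n k ≠ 0 := by
  obtain ⟨p, hp⟩ := computes_of_primrec (Nat.Primrec'.prim_iff₂.2 ht)
    (Fin.cons 0 (Fin.cons 2 Fin.elim0)) 3 4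
    (by intro i; fin_cases i <;> simp) (by omega)
    (by intro i; fin_cases i <;> simp)
  let body : Prog := .seq p (.seq (.inc 1) (.seq (.loop 3 (.loop 1 .nop)) (.inc 2)))
  let st : ℕ → ℕ → ℕ → ℕ → ℕ := fun n k fl x =>
    if x = 0 then n else if x = 1 then fl else if x = 2 then k else 0
  have hbody : ∀ n k, Ex body (st n k 0) (st n (k + 1) (if t n k = 0 then 1 else 0)) := by
    intro n k
    have h1 := hp (st n k 0) (fun x hx => by simp only [st]; split_ifs <;> omega) (by simp [st])
    have hv : t (List.Vector.ofFn fun i => st n k 0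
        ((Fin.cons 0 (Fin.cons 2 Fin.elim0) : Fin 2 → ℕ) i)).head
        (List.Vector.ofFn fun i => st n k 0
        ((Fin.cons 0 (Fin.cons 2 Fin.elim0) : Fin 2 → ℕ) i)).tail.head = t n k := by
      simp [List.Vector.ofFn, st]
    simp only [hv] at h1
    have h3 : Ex (.loop 3 (.loop 1 .nop)) (fun x => if x = 3 then t n k else st n k 1 x)
        (st n k (if t n k = 0 then 1 else 0)) := by
      refine (ex_loop_iter (t n k) (fun i x => if x = 3 then t n k - i else
        st n k (if i = 0 then 1 else 0) x) (fun i _ => by simp) (fun i hi => ?_)).congr ?_ ?_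
      · refine (ex_clear _ _).congr rfl ?_
        funext x
        simp only [Function.update_apply, st]
        grind
      · funext x; simp
      · funext x
        simp only [st]
        grind
    refine (ex_seq h1 (ex_seq (ex_inc _ _) (ex_seq (h3.congr ?_ rfl) (ex_inc _ _)))).congr rfl ?_
    · funext x
      simp only [Function.update_apply, st]
      grind
    · funext x
      simp only [Function.update_apply, st]
      grind
  have hloop : ∀ n k, PStep ([.loop 1 body], st n k 1) ([body, .loop 1 body], st n k 0) := by
    intro n k
    have := pstep_loop_succ (r := 1) (p := body) (s := st n k 1) (by simp [st]) []
    convert this using 2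
    funext x
    simp only [Function.update_apply, st]
    grind
  have hinit : ∀ n, PStep ([.seq (.inc 1) (.loop 1 body)], Function.update (fun _ => 0) 0 n)
      ([.inc 1, .loop 1 body], Function.update (fun _ => 0) 0 n) := by
    intro n; simp [PStep, mstep, Prog.ins]
  have hinit2 : ∀ n, PStep ([.inc 1, .loop 1 body], Function.update (fun _ => 0) 0 n)
      ([.loop 1 body], st n 0 1) := by
    intro n; simp [PStep, mstep, Prog.ins]
    funext x
    simp only [Function.update_apply, st]
    grind
  have hstep : ∀ n k, Relation.TransGen PStep ([.loop 1 body], st n k 1)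
      ([.loop 1 body], st n (k + 1) (if t n k = 0 then 1 else 0)) := fun n k =>
    Relation.TransGen.head' (hloop n k) (hbody n k _)
  refine ⟨.seq (.inc 1) (.loop 1 body), fun n => ⟨fun h => ?_, fun ⟨k, hk⟩ => ?_⟩⟩
  · by_contra! hcon
    have h1 : PAcc ([.loop 1 body], st n 0 1) :=
      Acc.inv (Acc.inv h (hinit n)) (hinit2 n)
    refine not_pacc_of_chain (fun k => ([.loop 1 body], st n k 1)) (fun k => ?_) h1
    have := hstep n k
    rwa [if_pos (hcon k)] at this
  · have hmin : ∀ d k, t n (k + d) ≠ 0 → PAcc ([.loop 1 body], st n k 1) := by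
      intro d
      induction d with
      | zero =>
        intro k hk
        refine pacc_of_reach (hstep n k).to_reflTransGen ?_
        rw [if_neg (by simpa using hk)]
        exact pacc_of_reach (ex_loop_zero (by simp [st]) []) (pacc_nil _)
      | succ d ih =>
        intro k hk
        refine pacc_of_reach (hstep n k).to_reflTransGen ?_
        split_ifs with h0
        · exact ih (k + 1) (by rwa [show k + 1 + d = k + (d + 1) by omega])
        · exact pacc_of_reach (ex_loop_zero (by simp [st]) []) (pacc_nil _)
    exact pacc_of_step (hinit n) (pacc_of_step (hinit2 n) (hmin k 0 (by simpa using hk)))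

/-- There is a program with undecidable halting problem. -/
theorem exists_undecidable_prog :
    ∃ P : Prog, ¬ ComputablePred fun n : ℕ =>
      ¬ PAcc ([P], Function.update (fun _ => 0) 0 n) := by
  let t : ℕ → ℕ → ℕ := fun n k =>
    Encodable.encode (Nat.Partrec.Code.evaln k (Denumerable.ofNat Nat.Partrec.Code n) 0)
  have ht : Primrec₂ t := by
    refine Primrec.encode.comp (Nat.Partrec.Code.primrec_evaln.comp
      (Primrec.pair (Primrec.pair Primrec.snd ((Primrec.ofNat _).comp Primrec.fst))
        (Primrec.const 0)))
  obtain ⟨P, hP⟩ := exists_search t ht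
  refine ⟨P, fun hc => ComputablePred.halting_problem 0 ?_⟩
  have hc2 := hc.not
  refine ComputablePred.computable_of_manyOneReducible ⟨fun c => Encodable.encode c,
    Computable.encode, fun c => ?_⟩ hc2
  show (Nat.Partrec.Code.eval c 0).Dom ↔ ¬ ¬ PAcc _
  rw [not_not, hP, Part.dom_iff_mem]
  constructor
  · rintro ⟨y, hy⟩
    obtain ⟨k, hk⟩ := Nat.Partrec.Code.evaln_complete.1 hy
    refine ⟨k, ?_⟩
    have : Nat.Partrec.Code.evaln k c 0 = some y := hk
    simp [t, this]
  · rintro ⟨k, hk⟩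
    cases h : Nat.Partrec.Code.evaln k c 0 with
    | none => simp [t, h] at hk
    | some y => exact ⟨y, Nat.Partrec.Code.evaln_sound h⟩

/-! ## The encoding formula -/

namespace TForm

def tor (φ ψ : TForm) : TForm := neg (and (neg φ) (neg ψ))
def timp (φ ψ : TForm) : TForm := neg (and φ (neg ψ))
def tK : TForm := atom 0
def tS : TForm := atom 1
def tI : TForm := atom 2
def tIn (i : ℕ) : TForm := atom (3 * i + 3)
def tOut (i : ℕ) : TForm := atom (3 * i + 4)
def tQ (i : ℕ) : TForm := atom (3 * i + 5)
def tbot : TForm := and tK (neg tK)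
/-- now or later -/
def ev (φ : TForm) : TForm := tor φ (diaF φ)
/-- for some element of the current domain -/
def ex (φ : TForm) : TForm := tor φ (exNe φ)
/-- for no element of the current domain -/
def no (φ : TForm) : TForm := neg (ex φ)
/-- always in the future -/
def box (φ : TForm) : TForm := neg (diaF (neg φ))
/-- at the next tick -/
def nx (φ : TForm) : TForm :=
  exNe (and (diaF (and tS φ)) (neg (diaF (and tK (diaF tS)))))
def cur (i : ℕ) : TForm := and (ev (tOut i)) (neg (ev (tIn i)))
def idle (i : ℕ) : TForm := and (no (tIn i)) (no (tOut i))
def incF (i : ℕ) : TForm := and (ex (tIn i)) (no (tOut i))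
def decF (i : ℕ) : TForm := and (ex (and (tOut i) (cur i))) (no (tIn i))
def zeroF (i : ℕ) : TForm := no (cur i)

def conj : List TForm → TForm
  | [] => neg tbot
  | φ :: l => and φ (conj l)

def only (m r : ℕ) (φ : TForm) : TForm :=
  conj ((List.range m).map fun i => if i = r then φ else idle i)
def allIdle (m : ℕ) : TForm := conj ((List.range m).map idle)

def insF {σ : Type} (q : σ → ℕ) (m : ℕ) : Ins σ → TForm
  | .halt => tbot
  | .inc r s => and (only m r (incF r)) (nx (tQ (q s)))
  | .jz r s1 s2 => tor (and (and (zeroF r) (allIdle m)) (nx (tQ (q s1))))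
      (and (only m r (decF r)) (nx (tQ (q s2))))
  | .jmp s => and (allIdle m) (nx (tQ (q s)))

/-- Axioms for counter `i`. -/
def axC (i : ℕ) : TForm :=
  conj [timp (tIn i) tK, timp (tIn i) (diaF (tOut i)), timp (tIn i) (neg (diaF (tIn i))),
    timp (tIn i) (neg (exNe (tIn i))), timp (tOut i) (neg (diaF (tOut i))),
    timp (and (tOut i) tK) (neg (exNe (tOut i))),
    timp (and (tOut i) (neg tK)) (no (diaF tK))]

def ax {σ : Type} (q : σ → ℕ) (ins : σ → Ins σ) (L : List σ) (m : ℕ) : TForm :=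
  and (and (timp tK (neg (exNe (neg tK)))) (and (timp tS tK) (timp tI (only m 0 (incF 0)))))
    (and (conj ((List.range m).map axC))
      (conj (L.map fun s => timp (tQ (q s)) (insF q m (ins s)))))

def theta (j : ℕ) : ℕ → TForm
  | 0 => tQ j
  | n + 1 => and tI (nx (theta j n))

def mainF {σ : Type} (q : σ → ℕ) (ins : σ → Ins σ) (L : List σ) (m : ℕ) (s0 : σ) (n : ℕ) : TForm :=
  and (no (neg (box (ax q ins L m))))
    (diaF (and (and tK (conj ((List.range m).map zeroF))) (theta (q s0) n)))

end TForm

section sem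
open TForm
variable {T U : Type} {lt : T → T → Prop} {D : T → Set U} {I : ℕ → T → U → Prop} {t : T} {a : U}

theorem sat_atom (n : ℕ) : TSat lt D I t a (.atom n) ↔ I n t a := Iff.rfl
theorem sat_neg (φ : TForm) : TSat lt D I t a (.neg φ) ↔ ¬ TSat lt D I t a φ := Iff.rfl
theorem sat_and (φ ψ : TForm) :
    TSat lt D I t a (.and φ ψ) ↔ TSat lt D I t a φ ∧ TSat lt D I t a ψ := Iff.rfl
theorem sat_diaF (φ : TForm) :
    TSat lt D I t a (.diaF φ) ↔ ∃ t', lt t t' ∧ a ∈ D t' ∧ TSat lt D I t' a φ := Iff.rfl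
theorem sat_exNe (φ : TForm) :
    TSat lt D I t a (.exNe φ) ↔ ∃ b, b ∈ D t ∧ b ≠ a ∧ TSat lt D I t b φ := Iff.rfl
theorem sat_tor (φ ψ : TForm) :
    TSat lt D I t a (tor φ ψ) ↔ TSat lt D I t a φ ∨ TSat lt D I t a ψ := by
  simp only [tor, sat_neg, sat_and]; tauto
theorem sat_timp (φ ψ : TForm) :
    TSat lt D I t a (timp φ ψ) ↔ (TSat lt D I t a φ → TSat lt D I t a ψ) := by
  simp only [timp, sat_neg, sat_and]; tauto
theorem sat_tbot : ¬ TSat lt D I t a tbot := by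
  simp only [tbot, sat_neg, sat_and]; tauto
theorem sat_ev (φ : TForm) : TSat lt D I t a (ev φ) ↔
    TSat lt D I t a φ ∨ ∃ t', lt t t' ∧ a ∈ D t' ∧ TSat lt D I t' a φ := by
  simp only [ev, sat_tor, sat_diaF]
theorem sat_ex (ha : a ∈ D t) (φ : TForm) : TSat lt D I t a (ex φ) ↔
    ∃ b, b ∈ D t ∧ TSat lt D I t b φ := by
  simp only [ex, sat_tor, sat_exNe]
  constructor
  · rintro (h | ⟨b, h1, _, h2⟩)
    exacts [⟨a, ha, h⟩, ⟨b, h1, h2⟩]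
  · rintro ⟨b, h1, h2⟩
    by_cases hb : b = a
    · subst hb; exact Or.inl h2
    · exact Or.inr ⟨b, h1, hb, h2⟩
theorem sat_no (ha : a ∈ D t) (φ : TForm) : TSat lt D I t a (no φ) ↔
    ∀ b, b ∈ D t → ¬ TSat lt D I t b φ := by
  simp only [no, sat_neg, sat_ex ha]; push Not; rfl
theorem sat_box (φ : TForm) : TSat lt D I t a (box φ) ↔
    ∀ t', lt t t' → a ∈ D t' → TSat lt D I t' a φ := by
  simp only [box, sat_neg, sat_diaF]; push Not; rfl
theorem sat_conj (l : List TForm) : TSat lt D I t a (conj l) ↔ ∀ φ ∈ l, TSat lt D I t a φ := by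
  induction l with
  | nil => simpa [conj, sat_neg] using sat_tbot
  | cons φ l ih => simp [conj, sat_and, ih]
theorem sat_only (m r : ℕ) (φ : TForm) : TSat lt D I t a (only m r φ) ↔
    ∀ i, i < m → ((i = r → TSat lt D I t a φ) ∧ (i ≠ r → TSat lt D I t a (idle i))) := by
  simp only [only, sat_conj, List.mem_map, List.mem_range]
  constructor
  · intro h i hi
    have := h _ ⟨i, hi, rfl⟩
    constructor
    · intro h1; rwa [if_pos h1] at this
    · intro h1; rwa [if_neg h1] at this
  · rintro h _ ⟨i, hi, rfl⟩
    split_ifs with h1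
    · exact (h i hi).1 h1
    · exact (h i hi).2 h1
theorem sat_allIdle (m : ℕ) : TSat lt D I t a (allIdle m) ↔
    ∀ i, i < m → TSat lt D I t a (idle i) := by
  simp [allIdle, sat_conj]

end sem

/-! ## Soundness -/

section soundness
open TForm
variable {T U : Type} [LinearOrder T] {D : T → Set U} {I : ℕ → T → U → Prop}

/-- Semantic content of the axioms for one counter, at all points after the root. -/
structure CtrAx (D : T → Set U) (I : ℕ → T → U → Prop) (r : T) (i : ℕ) : Prop where
  inK : ∀ t x, r < t → x ∈ D t → I (3 * i + 3) t x → I 0 t x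
  inOut : ∀ t x, r < t → x ∈ D t → I (3 * i + 3) t x → ∃ u, t < u ∧ x ∈ D u ∧ I (3 * i + 4) u x
  inIn : ∀ t x, r < t → x ∈ D t → I (3 * i + 3) t x → ¬ ∃ u, t < u ∧ x ∈ D u ∧ I (3 * i + 3) u x
  inOne : ∀ t x, r < t → x ∈ D t → I (3 * i + 3) t x → ∀ y ∈ D t, I (3 * i + 3) t y → y = x
  outOut : ∀ t x, r < t → x ∈ D t → I (3 * i + 4) t x → ¬ ∃ u, t < u ∧ x ∈ D u ∧ I (3 * i + 4) u x
  outOne : ∀ t x, r < t → x ∈ D t → I (3 * i + 4) t x → I 0 t x →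
    ∀ y ∈ D t, I (3 * i + 4) t y → y = x
  outEnd : ∀ t x, r < t → x ∈ D t → I (3 * i + 4) t x → ¬ I 0 t x →
    ∀ y ∈ D t, ¬ ∃ u, t < u ∧ y ∈ D u ∧ I 0 u y

theorem ctrAx_of_sat {r : T} {i : ℕ}
    (h : ∀ t x, r < t → x ∈ D t → TSat (fun a b : T => a < b) D I t x (axC i)) :
    CtrAx D I r i := by
  have h' : ∀ t x, r < t → x ∈ D t → _ := fun t x ht hx => (sat_conj _).1 (h t x ht hx)
  simp only [List.mem_cons, List.not_mem_nil, or_false, forall_eq_or_imp, forall_eq,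
    sat_timp, sat_neg, sat_diaF, sat_exNe, sat_and, tIn, tOut, tK, sat_atom] at h'
  constructor
  · intro t x ht hx; exact (h' t x ht hx).1
  · intro t x ht hx; exact (h' t x ht hx).2.1
  · intro t x ht hx; exact (h' t x ht hx).2.2.1
  · intro t x ht hx h1 y hy h2
    by_contra hne
    exact (h' t x ht hx).2.2.2.1 h1 ⟨y, hy, hne, h2⟩
  · intro t x ht hx; exact (h' t x ht hx).2.2.2.2.1
  · intro t x ht hx h1 hk y hy h2
    by_contra hne
    exact (h' t x ht hx).2.2.2.2.2.1 ⟨h1, hk⟩ ⟨y, hy, hne, h2⟩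
  · intro t x ht hx h1 hk y hy
    have := (h' t x ht hx).2.2.2.2.2.2 ⟨h1, hk⟩
    rw [sat_no hx] at this
    exact this y hy

/-- The current elements of counter `i` at time `t`. -/
def CurSet (D : T → Set U) (I : ℕ → T → U → Prop) (i : ℕ) (t : T) : Set U :=
  {x | x ∈ D t ∧ (∃ u, t ≤ u ∧ x ∈ D u ∧ I (3 * i + 4) u x) ∧
    ∀ u, t ≤ u → x ∈ D u → ¬ I (3 * i + 3) u x}

theorem sat_cur {i : ℕ} {t : T} {x : U} (hx : x ∈ D t) :
    TSat (fun a b : T => a < b) D I t x (cur i) ↔ x ∈ CurSet D I i t := by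
  simp only [cur, sat_and, sat_neg, sat_ev, tIn, tOut, sat_atom, CurSet, Set.mem_setOf_eq]
  constructor
  · rintro ⟨h1, h2⟩
    refine ⟨hx, ?_, ?_⟩
    · rcases h1 with h1 | ⟨u, hu, h3, h4⟩
      · exact ⟨t, le_rfl, hx, h1⟩
      · exact ⟨u, hu.le, h3, h4⟩
    · intro u hu h3 h4
      rcases hu.eq_or_lt with rfl | hu
      · exact h2 (Or.inl h4)
      · exact h2 (Or.inr ⟨u, hu, h3, h4⟩)
  · rintro ⟨_, ⟨u, hu, h3, h4⟩, h5⟩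
    refine ⟨?_, ?_⟩
    · rcases hu.eq_or_lt with rfl | hu
      · exact Or.inl h4
      · exact Or.inr ⟨u, hu, h3, h4⟩
    · rintro (h6 | ⟨u, hu, h6, h7⟩)
      · exact h5 t le_rfl hx h6
      · exact h5 u hu.le h6 h7

/-- `w` is a tick after `t`, with no tick strictly in between. -/
structure NextTick (D : T → Set U) (I : ℕ → T → U → Prop) (t w : T) (z : U) : Prop where
  lt : t < w
  mem : z ∈ D w
  tick : I 0 w z
  gap : ∀ v, t < v → v < w → ∀ y ∈ D v, ¬ I 0 v y

variable {r : T}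

theorem dmono (hD : ∀ t t' : T, t < t' → D t' ⊆ D t)
    {t t' : T} (h : t ≤ t') : D t' ⊆ D t := by
  rcases h.eq_or_lt with rfl | h
  · exact subset_rfl
  · exact hD _ _ h

/-- No events strictly between successive ticks. -/
theorem no_between (hD : ∀ t t' : T, t < t' → D t' ⊆ D t)
    {i : ℕ} (A : CtrAx D I r i) {t w : T} {z : U} (hr : r < t)
    (N : NextTick D I t w z) {v : T} (h1 : t < v) (h2 : v < w) {y : U} (hy : y ∈ D v) :
    ¬ I (3 * i + 3) v y ∧ ¬ I (3 * i + 4) v y := by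
  refine ⟨fun h => N.gap v h1 h2 y hy (A.inK v y (hr.trans h1) hy h), fun h => ?_⟩
  refine A.outEnd v y (hr.trans h1) hy h (N.gap v h1 h2 y hy) z (hD _ _ h2 N.mem) ?_
  exact ⟨w, h2, N.mem, N.tick⟩

theorem cur_common (hD : ∀ t t' : T, t < t' → D t' ⊆ D t)
    {i : ℕ} (A : CtrAx D I r i) {t w : T} {z : U} (hr : r < t)
    (N : NextTick D I t w z) {x : U} (h1 : ¬ I (3 * i + 3) t x) (h2 : ¬ I (3 * i + 4) t x) :
    x ∈ CurSet D I i t ↔ x ∈ CurSet D I i w := by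
  constructor
  · rintro ⟨hx, ⟨u, hu, hxu, hout⟩, hin⟩
    have hwu : w ≤ u := by
      by_contra! hlt
      rcases hu.eq_or_lt with rfl | hu
      · exact h2 hout
      · exact (no_between hD A hr N hu hlt hxu).2 hout
    exact ⟨dmono hD hwu hxu, ⟨u, hwu, hxu, hout⟩, fun u' hu' => hin u' (N.lt.le.trans hu')⟩
  · rintro ⟨hx, ⟨u, hu, hxu, hout⟩, hin⟩
    refine ⟨hD _ _ N.lt hx, ⟨u, N.lt.le.trans hu, hxu, hout⟩, fun v hv hxv hI => ?_⟩
    rcases hv.eq_or_lt with rfl | hv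
    · exact h1 hI
    · rcases lt_or_ge v w with hvw | hvw
      · exact (no_between hD A hr N hv hvw hxv).1 hI
      · exact hin v hvw hxv hI

theorem cur_idle (hD : ∀ t t' : T, t < t' → D t' ⊆ D t)
    {i : ℕ} (A : CtrAx D I r i) {t w : T} {z a : U} (hr : r < t) (ha : a ∈ D t)
    (N : NextTick D I t w z) (h : TSat (fun a b : T => a < b) D I t a (idle i)) :
    CurSet D I i w = CurSet D I i t := by
  simp only [idle, sat_and, sat_no ha, tIn, tOut, sat_atom] at h
  ext x
  by_cases hx : x ∈ D t
  · exact (cur_common hD A hr N (h.1 x hx) (h.2 x hx)).symm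
  · exact ⟨fun h => (hx (hD _ _ N.lt h.1)).elim, fun h => (hx h.1).elim⟩

theorem cur_inc (hD : ∀ t t' : T, t < t' → D t' ⊆ D t)
    {i : ℕ} (A : CtrAx D I r i) {t w : T} {z a : U} (hr : r < t) (ha : a ∈ D t)
    (N : NextTick D I t w z) (h : TSat (fun a b : T => a < b) D I t a (incF i)) :
    (CurSet D I i w).encard = (CurSet D I i t).encard + 1 := by
  simp only [incF, sat_and, sat_no ha, sat_ex ha, tIn, tOut, sat_atom] at h
  obtain ⟨⟨b, hb, hin⟩, hout⟩ := h
  have hnot : b ∉ CurSet D I i t := fun h => h.2.2 t le_rfl hb hin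
  have : CurSet D I i w = insert b (CurSet D I i t) := by
    ext x
    rw [Set.mem_insert_iff]
    by_cases hxb : x = b
    · subst hxb
      simp only [true_or, iff_true]
      obtain ⟨u, hu, hxu, ho⟩ := A.inOut t x hr hb hin
      have hwu : w ≤ u := by
        by_contra! hlt
        exact (no_between hD A hr N hu hlt hxu).2 ho
      exact ⟨dmono hD hwu hxu, ⟨u, hwu, hxu, ho⟩, fun v hv hxv hI =>
        A.inIn t x hr hb hin ⟨v, N.lt.trans_le hv, hxv, hI⟩⟩
    · simp only [hxb, false_or]
      by_cases hx : x ∈ D t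
      · exact (cur_common hD A hr N (fun h => hxb (A.inOne t b hr hb hin x hx h)) (hout x hx)).symm
      · exact ⟨fun h => (hx (hD _ _ N.lt h.1)).elim, fun h => (hx h.1).elim⟩
  rw [this, Set.encard_insert_of_notMem hnot]

theorem cur_dec (hD : ∀ t t' : T, t < t' → D t' ⊆ D t)
    {i : ℕ} (A : CtrAx D I r i) {t w : T} {z a : U} (hr : r < t) (ha : a ∈ D t)
    (hK : ∀ y ∈ D t, I 0 t y)
    (N : NextTick D I t w z) (h : TSat (fun a b : T => a < b) D I t a (decF i)) :
    (CurSet D I i t).encard = (CurSet D I i w).encard + 1 := by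
  simp only [decF, sat_and, sat_no ha, sat_ex ha, tIn, tOut, sat_atom] at h
  obtain ⟨⟨b, hb, hout, hcur⟩, hin⟩ := h
  rw [sat_cur hb] at hcur
  have hnot : b ∉ CurSet D I i w := by
    rintro ⟨hx, ⟨u, hu, hxu, ho⟩, _⟩
    exact A.outOut t b hr hb hout ⟨u, N.lt.trans_le hu, hxu, ho⟩
  have : CurSet D I i t = insert b (CurSet D I i w) := by
    ext x
    rw [Set.mem_insert_iff]
    by_cases hxb : x = b
    · subst hxb
      simp [hcur]
    · simp only [hxb, false_or]
      by_cases hx : x ∈ D t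
      · exact cur_common hD A hr N (hin x hx)
          (fun h => hxb (A.outOne t b hr hb hout (hK b hb) x hx h))
      · exact ⟨fun h => (hx h.1).elim, fun h => (hx (hD _ _ N.lt h.1)).elim⟩
  rw [this, Set.encard_insert_of_notMem hnot]

/-- A tick with counter contents `c`. -/
structure Good (D : T → Set U) (I : ℕ → T → U → Prop) (r : T) (m : ℕ) (t : T) (x : U)
    (c : ℕ → ℕ) : Prop where
  after : r < t
  mem : x ∈ D t
  tick : I 0 t x
  cnt : ∀ i, i < m → (CurSet D I i t).encard = (c i : ℕ∞)

theorem next_of_nx (hD : ∀ t t' : T, t < t' → D t' ⊆ D t)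
    {t : T} {x : U} (hr : r < t) {φ : TForm}
    (hKu : ∀ t x, r < t → x ∈ D t → I 0 t x → ∀ y ∈ D t, I 0 t y)
    (hS : ∀ t x, r < t → x ∈ D t → I 1 t x → I 0 t x)
    (h : TSat (fun a b : T => a < b) D I t x (nx φ)) :
    ∃ w z, NextTick D I t w z ∧ TSat (fun a b : T => a < b) D I w z φ := by
  simp only [nx, sat_exNe, sat_and, sat_neg, sat_diaF, tS, tK, sat_atom] at h
  obtain ⟨z, hz, _, ⟨w, htw, hzw, hs, hφ⟩, hno⟩ := h
  refine ⟨w, z, ⟨htw, hzw, hS w z (hr.trans htw) hzw hs, fun v h1 h2 y hy hk => ?_⟩, hφ⟩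
  have hzv : z ∈ D v := hD _ _ h2 hzw
  exact hno ⟨v, h1, hzv, hKu v y (hr.trans h1) hy hk z hzv, w, h2, hzw, hs⟩

theorem good_update {m : ℕ} {t w : T} {x z : U} {c c' : ℕ → ℕ} (G : Good D I r m t x c)
    (N : NextTick D I t w z)
    (h : ∀ i, i < m → (CurSet D I i w).encard = (c' i : ℕ∞)) : Good D I r m w z c' :=
  ⟨G.after.trans N.lt, N.mem, N.tick, h⟩

theorem good_idle (hD : ∀ t t' : T, t < t' → D t' ⊆ D t)
    {m : ℕ} {t w : T} {x z : U} {c : ℕ → ℕ} (A : ∀ i, i < m → CtrAx D I r i)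
    (G : Good D I r m t x c) (N : NextTick D I t w z)
    (h : TSat (fun a b : T => a < b) D I t x (allIdle m)) : Good D I r m w z c := by
  rw [sat_allIdle] at h
  refine good_update G N fun i hi => ?_
  rw [cur_idle hD (A i hi) G.after G.mem N (h i hi), G.cnt i hi]

theorem good_inc (hD : ∀ t t' : T, t < t' → D t' ⊆ D t)
    {m : ℕ} {t w : T} {x z : U} {c : ℕ → ℕ} {k : ℕ} (A : ∀ i, i < m → CtrAx D I r i)
    (G : Good D I r m t x c) (N : NextTick D I t w z)
    (h : TSat (fun a b : T => a < b) D I t x (only m k (incF k))) :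
    Good D I r m w z (Function.update c k (c k + 1)) := by
  rw [sat_only] at h
  refine good_update G N fun i hi => ?_
  by_cases hk : i = k
  · have h1 := (h i hi).1 hk
    subst hk
    rw [cur_inc hD (A i hi) G.after G.mem N h1, G.cnt i hi]
    simp
  · rw [cur_idle hD (A i hi) G.after G.mem N ((h i hi).2 hk), G.cnt i hi]
    simp [Function.update, hk]

theorem good_dec (hD : ∀ t t' : T, t < t' → D t' ⊆ D t)
    {m : ℕ} {t w : T} {x z : U} {c : ℕ → ℕ} {k : ℕ} (A : ∀ i, i < m → CtrAx D I r i)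
    (hKu : ∀ t x, r < t → x ∈ D t → I 0 t x → ∀ y ∈ D t, I 0 t y) (hkm : k < m)
    (G : Good D I r m t x c) (N : NextTick D I t w z)
    (h : TSat (fun a b : T => a < b) D I t x (only m k (decF k))) :
    c k ≠ 0 ∧ Good D I r m w z (Function.update c k (c k - 1)) := by
  rw [sat_only] at h
  have h1 := cur_dec hD (A k hkm) G.after G.mem (hKu t x G.after G.mem G.tick) N ((h k hkm).1 rfl)
  rw [G.cnt k hkm] at h1
  have hfin : (CurSet D I k w).encard ≠ ⊤ := by
    intro ht; rw [ht] at h1; simp at h1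
  obtain ⟨d, hd⟩ := ENat.ne_top_iff_exists.1 hfin
  rw [← hd] at h1
  have h2 : c k = d + 1 := by exact_mod_cast h1
  refine ⟨by omega, good_update G N fun i hi => ?_⟩
  by_cases hk : i = k
  · subst hk
    rw [← hd]; simp [h2]
  · rw [cur_idle hD (A i hi) G.after G.mem N ((h i hi).2 hk), G.cnt i hi]
    simp [Function.update, hk]

theorem zero_of_sat {m : ℕ} {t : T} {x : U} {c : ℕ → ℕ} {k : ℕ} (hkm : k < m)
    (G : Good D I r m t x c) (h : TSat (fun a b : T => a < b) D I t x (zeroF k)) : c k = 0 := by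
  rw [zeroF, sat_no G.mem] at h
  have : CurSet D I k t = ∅ := by
    ext y
    simp only [Set.mem_empty_iff_false, iff_false]
    intro hy
    exact h y hy.1 ((sat_cur hy.1).2 hy)
  have h2 := G.cnt k hkm
  rw [this, Set.encard_empty] at h2
  exact_mod_cast h2.symm

theorem sound {σ : Type} (q : σ → ℕ) (ins : σ → Ins σ) (L : List σ) (m : ℕ) (s0 : σ) (n : ℕ)
    (hm : 0 < m) (hL : ∀ s ∈ L, InsOk L m (ins s)) (hs0 : s0 ∈ L)
    (h : FOLTLDecSat (fun a b : T => a < b) (mainF q ins L m s0 n)) :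
    ¬ Acc (fun c' c => mstep ins c = some c') (s0, Function.update (fun _ => 0) 0 n) := by
  obtain ⟨U, D, _, hD, I, r, a, ha, hsat⟩ := h
  simp only [mainF, sat_and, sat_no ha, sat_neg, not_not, sat_box] at hsat
  obtain ⟨hax, hst⟩ := hsat
  have hax' : ∀ t x, r < t → x ∈ D t → TSat (fun a b : T => a < b) D I t x (ax q ins L m) :=
    fun t x ht hx => hax x (hD _ _ ht hx) t ht hx
  have hKu : ∀ t x, r < t → x ∈ D t → I 0 t x → ∀ y ∈ D t, I 0 t y := by
    intro t x ht hx hk y hy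
    have h1 := (hax' t x ht hx).1.1
    rw [sat_timp, sat_neg, sat_exNe] at h1
    by_contra hcon
    exact h1 hk ⟨y, hy, fun he => hcon (he ▸ hk), hcon⟩
  have hS : ∀ t x, r < t → x ∈ D t → I 1 t x → I 0 t x := by
    intro t x ht hx
    have h1 := (hax' t x ht hx).1.2.1
    rwa [sat_timp] at h1
  have hI : ∀ t x, r < t → x ∈ D t → I 2 t x →
      TSat (fun a b : T => a < b) D I t x (only m 0 (incF 0)) := by
    intro t x ht hx
    have h1 := (hax' t x ht hx).1.2.2
    rwa [sat_timp] at h1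
  have A : ∀ i, i < m → CtrAx D I r i := by
    intro i hi
    refine ctrAx_of_sat fun t x ht hx => ?_
    have h1 := (hax' t x ht hx).2.1
    rw [sat_conj] at h1
    exact h1 _ (List.mem_map.2 ⟨i, List.mem_range.2 hi, rfl⟩)
  have hQ : ∀ s ∈ L, ∀ t x, r < t → x ∈ D t → I (3 * q s + 5) t x →
      TSat (fun a b : T => a < b) D I t x (insF q m (ins s)) := by
    intro s hs t x ht hx
    have h1 := (hax' t x ht hx).2.2
    rw [sat_conj] at h1
    have h2 := h1 _ (List.mem_map.2 ⟨s, hs, rfl⟩)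
    rwa [sat_timp] at h2
  -- the initial phase
  have hth : ∀ k t x c, Good D I r m t x c →
      TSat (fun a b : T => a < b) D I t x (theta (q s0) k) →
      ∃ t' x', Good D I r m t' x' (Function.update c 0 (c 0 + k)) ∧ I (3 * q s0 + 5) t' x' := by
    intro k
    induction k with
    | zero => intro t x c G h; exact ⟨t, x, by simpa using G, h⟩
    | succ k ih =>
      intro t x c G h
      obtain ⟨h1, h2⟩ := h
      obtain ⟨w, z, N, hz⟩ := next_of_nx hD G.after hKu hS h2
      obtain ⟨t', x', G', hq⟩ := ih w z _ (good_inc hD A G N (hI t x G.after G.mem h1)) hz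
      refine ⟨t', x', ?_, hq⟩
      have : c 0 + 1 + k = c 0 + (k + 1) := by omega
      simpa [this] using G'
  -- the run
  have hrun : ∀ cf : σ × (ℕ → ℕ), Acc (fun c' c => mstep ins c = some c') cf →
      ∀ t x, Good D I r m t x cf.2 → I (3 * q cf.1 + 5) t x → cf.1 ∈ L → False := by
    intro cf hacc
    induction hacc with
    | intro cf _ ih =>
      obtain ⟨s, c⟩ := cf
      intro t x G hq hs
      have h1 := hQ s hs t x G.after G.mem hq
      have h2 := hL s hs
      cases hi : ins s with
      | halt => rw [hi] at h1; exact sat_tbot h1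
      | inc k s' =>
        rw [hi] at h1 h2
        obtain ⟨w, z, N, hz⟩ := next_of_nx hD G.after hKu hS h1.2
        exact ih (s', Function.update c k (c k + 1)) (by simp [mstep, hi]) w z
          (good_inc hD A G N h1.1) hz h2.2
      | jmp s' =>
        rw [hi] at h1 h2
        obtain ⟨w, z, N, hz⟩ := next_of_nx hD G.after hKu hS h1.2
        exact ih (s', c) (by simp [mstep, hi]) w z (good_idle hD A G N h1.1) hz h2
      | jz k s1 s2 =>
        rw [hi] at h1 h2
        simp only [insF, sat_tor] at h1
        rcases h1 with ⟨⟨hz0, hid⟩, h1⟩ | ⟨hdec, h1⟩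
        · obtain ⟨w, z, N, hz⟩ := next_of_nx hD G.after hKu hS h1
          have hc0 := zero_of_sat h2.1 G hz0
          simp only at hc0
          exact ih (s1, c) (by simp [mstep, hi, hc0]) w z (good_idle hD A G N hid) hz h2.2.1
        · obtain ⟨w, z, N, hz⟩ := next_of_nx hD G.after hKu hS h1
          obtain ⟨hc0, G'⟩ := good_dec hD A hKu h2.1 G N hdec
          simp only at hc0
          exact ih (s2, Function.update c k (c k - 1)) (by simp [mstep, hi, hc0]) w z G' hz h2.2.2
  intro hacc
  obtain ⟨t, hrt, hat, ⟨hk, hz⟩, hθ⟩ := hst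
  have G : Good D I r m t a (fun _ => 0) := by
    refine ⟨hrt, hat, hk, fun i hi => ?_⟩
    rw [sat_conj] at hz
    have h1 := hz _ (List.mem_map.2 ⟨i, List.mem_range.2 hi, rfl⟩)
    rw [zeroF, sat_no hat] at h1
    have : CurSet D I i t = ∅ := by
      ext y
      simp only [Set.mem_empty_iff_false, iff_false]
      intro hy
      exact h1 y hy.1 ((sat_cur hy.1).2 hy)
    rw [this]; simp
  obtain ⟨t', x', G', hq⟩ := hth n t a _ G hθ
  refine hrun _ hacc t' x' ?_ hq hs0
  simpa using G'

end soundness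

/-! ## Completeness -/

/-- Last-in-first-out matching of increments and decrements of a counter. -/
def OutAt (d : ℕ → ℕ) (x j : ℕ) : Prop :=
  x < j ∧ d (j + 1) ≤ d x ∧ ∀ l, x < l → l ≤ j → d x < d l

/-- A counter history. -/
structure Hist (d : ℕ → ℕ) : Prop where
  zero : d 0 = 0
  up : ∀ j, d (j + 1) ≤ d j + 1
  down : ∀ j, d j ≤ d (j + 1) + 1

theorem OutAt.unique {d : ℕ → ℕ} {x j j' : ℕ} (h : OutAt d x j) (h' : OutAt d x j') :
    ¬ j < j' := by
  intro hlt
  have h1 := h'.2.2 (j + 1) (by have := h.1; omega) hlt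
  have h2 := h.2.1
  omega

theorem OutAt.never {d : ℕ → ℕ} {x j : ℕ} (h : OutAt d x j) (h' : ∀ l, x < l → d x < d l) :
    False := by
  have h1 := h' (j + 1) (by have := h.1; omega)
  have h2 := h.2.1
  omega

theorem OutAt.inj {d : ℕ → ℕ} (H : Hist d) {x x' j : ℕ} (h : OutAt d x j) (h' : OutAt d x' j) :
    ¬ x < x' := by
  intro hlt
  have h1 := h.2.2 x' hlt h'.1.le
  have h2 := h'.2.2 j h'.1 le_rfl
  have h3 := h.2.1
  have h4 := H.down j
  omega

theorem OutAt.dec {d : ℕ → ℕ} {x j : ℕ} (h : OutAt d x j) : d (j + 1) < d j := by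
  have h2 := h.2.2 j h.1 le_rfl
  have h3 := h.2.1
  omega

theorem out_of_in {d : ℕ → ℕ} {x : ℕ} (h : d (x + 1) = d x + 1) :
    (∀ l, x < l → d x < d l) ∨ ∃ j, OutAt d x j := by
  by_cases hn : ∀ l, x < l → d x < d l
  · exact Or.inl hn
  · right
    push Not at hn
    classical
    have hs := Nat.find_spec hn
    have hm := fun l => Nat.find_min hn (m := l)
    generalize Nat.find hn = l0 at hs hm
    have hne : l0 ≠ x + 1 := by rintro rfl; omega
    obtain ⟨j, rfl⟩ : ∃ j, l0 = j + 1 := ⟨l0 - 1, by omega⟩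
    refine ⟨j, by omega, hs.2, fun l h1 h2 => ?_⟩
    by_contra hc
    exact hm l (by omega) ⟨h1, by omega⟩

theorem out_of_dec {d : ℕ → ℕ} (H : Hist d) {j : ℕ} (h : d j = d (j + 1) + 1) :
    ∃ x, OutAt d x j := by
  have key : ∀ k, k ≤ j → (∀ l, k ≤ l → l ≤ j → d j ≤ d l) → ∃ x, OutAt d x j := by
    intro k
    induction k with
    | zero =>
      intro _ hl
      have := hl 0 le_rfl (Nat.zero_le _)
      rw [H.zero] at this
      omega
    | succ k ih =>
      intro hk hl
      by_cases hc : d j ≤ d k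
      · refine ih (by omega) fun l h1 h2 => ?_
        rcases Nat.eq_or_lt_of_le h1 with rfl | h1
        · exact hc
        · exact hl l h1 h2
      · have h1 := hl (k + 1) le_rfl hk
        have h2 := H.up k
        refine ⟨k, by omega, by omega, fun l h3 h4 => ?_⟩
        have := hl l h3 h4
        omega
  exact key j le_rfl fun l h1 h2 => by rw [le_antisymm h1 h2]

section completeness
open TForm

theorem csat_ex {T U : Type} {lt : T → T → Prop} {I : ℕ → T → U → Prop} {t : T} {a : U}
    (φ : TForm) : TSat lt (fun _ => Set.univ) I t a (ex φ) ↔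
    ∃ b, TSat lt (fun _ => Set.univ) I t b φ := by
  rw [sat_ex (D := fun _ => Set.univ) (Set.mem_univ a)]; simp

theorem csat_no {T U : Type} {lt : T → T → Prop} {I : ℕ → T → U → Prop} {t : T} {a : U}
    (φ : TForm) : TSat lt (fun _ => Set.univ) I t a (no φ) ↔
    ∀ b, ¬ TSat lt (fun _ => Set.univ) I t b φ := by
  rw [sat_no (D := fun _ => Set.univ) (Set.mem_univ a)]; simp

variable {T : Type} [LinearOrder T]

/-- The interpretation built from ticks `f`, end point `e`, states `st`, counters `c`. -/
def modI {σ : Type} (q : σ → ℕ) (f : ℕ → T) (e : T) (st : ℕ → Option σ) (c : ℕ → ℕ → ℕ) :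
    ℕ → T → ℕ → Prop
  | 0 => fun t _ => ∃ j, t = f j
  | 1 => fun t x => t = f x
  | 2 => fun t x => t = f x ∧ st x = none
  | k + 3 => fun t x =>
    (k % 3 = 0 ∧ t = f x ∧ c (x + 1) (k / 3) = c x (k / 3) + 1) ∨
    (k % 3 = 1 ∧ ((∃ j, t = f j ∧ OutAt (fun l => c l (k / 3)) x j) ∨
      (t = e ∧ ∀ l, x < l → c x (k / 3) < c l (k / 3)))) ∨
    (k % 3 = 2 ∧ t = f x ∧ ∃ s, st x = some s ∧ q s = k / 3)

variable {σ : Type} {q : σ → ℕ} {f : ℕ → T} {e : T} {st : ℕ → Option σ} {c : ℕ → ℕ → ℕ}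

theorem modI_in {i : ℕ} {t : T} {x : ℕ} : modI q f e st c (3 * i + 3) t x ↔
    t = f x ∧ c (x + 1) i = c x i + 1 := by
  have h1 : (3 * i) % 3 = 0 := by omega
  have h2 : (3 * i) / 3 = i := by omega
  simp [modI, h1, h2]

theorem modI_out {i : ℕ} {t : T} {x : ℕ} : modI q f e st c (3 * i + 4) t x ↔
    (∃ j, t = f j ∧ OutAt (fun l => c l i) x j) ∨ (t = e ∧ ∀ l, x < l → c x i < c l i) := by
  have h1 : (3 * i + 1) % 3 = 1 := by omega
  have h2 : (3 * i + 1) / 3 = i := by omega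
  change modI q f e st c ((3 * i + 1) + 3) t x ↔ _
  simp only [modI, h1, h2]
  simp

theorem modI_q {i : ℕ} {t : T} {x : ℕ} : modI q f e st c (3 * i + 5) t x ↔
    t = f x ∧ ∃ s, st x = some s ∧ q s = i := by
  have h1 : (3 * i + 2) % 3 = 2 := by omega
  have h2 : (3 * i + 2) / 3 = i := by omega
  change modI q f e st c ((3 * i + 2) + 3) t x ↔ _
  simp only [modI, h1, h2]
  simp

/-- Truth in the constructed model. -/
abbrev MS (q : σ → ℕ) (f : ℕ → T) (e : T) (st : ℕ → Option σ) (c : ℕ → ℕ → ℕ)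
    (t : T) (x : ℕ) (φ : TForm) : Prop :=
  TSat (fun a b : T => a < b) (fun _ => Set.univ) (modI q f e st c) t x φ

theorem ms_axC (hf : StrictMono f) (he : ∀ k, f k < e) {i : ℕ} (H : Hist fun l => c l i)
    (t : T) (x : ℕ) : MS q f e st c t x (axC i) := by
  rw [MS, axC, sat_conj]
  simp only [List.mem_cons, List.not_mem_nil, or_false, forall_eq_or_imp, forall_eq,
    sat_timp, sat_neg, sat_diaF, sat_exNe, sat_and, tIn, tOut, tK, sat_atom, csat_no,
    modI_in, modI_out, Set.mem_univ, true_and, true_implies]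
  refine ⟨?_, ?_, ?_, ?_, ?_, ?_, ?_⟩
  · rintro ⟨rfl, _⟩; exact ⟨x, rfl⟩
  · rintro ⟨rfl, h⟩
    rcases out_of_in (d := fun l => c l i) h with h | ⟨j, h⟩
    · exact ⟨e, he x, Or.inr ⟨rfl, h⟩⟩
    · exact ⟨f j, hf h.1, Or.inl ⟨j, rfl, h⟩⟩
  · rintro ⟨rfl, h⟩ ⟨u, hu, rfl, _⟩
    exact lt_irrefl _ hu
  · rintro ⟨rfl, h⟩ ⟨y, hy, h1, _⟩
    exact hy (hf.injective h1).symm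
  · rintro (⟨j, rfl, h⟩ | ⟨rfl, h⟩) ⟨u, hu, ⟨j', rfl, h'⟩ | ⟨rfl, h'⟩⟩
    · exact h.unique h' (hf.lt_iff_lt.1 hu)
    · exact h.never h'
    · exact h'.never h
    · exact lt_irrefl _ hu
  · rintro ⟨⟨j, rfl, h⟩ | ⟨rfl, h⟩, ⟨k, hk⟩⟩ ⟨y, hy, ⟨j', h1, h'⟩ | ⟨h1, h'⟩⟩
    · cases hf.injective h1
      rcases lt_or_gt_of_ne hy with hlt | hlt
      · exact h'.inj H h hlt
      · exact h.inj H h' hlt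
    · exact (he j).ne h1
    · exact (he k).ne' hk
    · exact (he k).ne' hk
  · rintro ⟨⟨j, rfl, h⟩ | ⟨rfl, h⟩, hk⟩
    · exact (hk ⟨j, rfl⟩).elim
    · rintro y ⟨u, hu, ⟨k, rfl⟩⟩
      exact lt_asymm hu (he k)

theorem ms_idle (hf : StrictMono f) (he : ∀ k, f k < e) {i j x : ℕ} (h : c (j + 1) i = c j i) :
    MS q f e st c (f j) x (idle i) := by
  simp only [MS, idle, sat_and, csat_no, tIn, tOut, sat_atom, modI_in, modI_out]
  refine ⟨?_, ?_⟩
  · rintro b ⟨h1, h2⟩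
    cases hf.injective h1
    omega
  · rintro b (⟨k, h1, h2⟩ | ⟨h1, _⟩)
    · cases hf.injective h1
      have := h2.dec
      omega
    · exact (he j).ne h1

theorem ms_inc (hf : StrictMono f) (he : ∀ k, f k < e) {i j x : ℕ} (h : c (j + 1) i = c j i + 1) :
    MS q f e st c (f j) x (incF i) := by
  simp only [MS, incF, sat_and, csat_no, csat_ex,
    tIn, tOut, sat_atom, modI_in, modI_out]
  refine ⟨⟨j, rfl, h⟩, ?_⟩
  rintro b (⟨k, h1, h2⟩ | ⟨h1, _⟩)
  · cases hf.injective h1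
    have := h2.dec
    omega
  · exact (he j).ne h1

theorem ms_dec (hf : StrictMono f) (he : ∀ k, f k < e) {i j x : ℕ} (H : Hist fun l => c l i)
    (h : c j i = c (j + 1) i + 1) : MS q f e st c (f j) x (decF i) := by
  simp only [MS, decF, cur, sat_and, csat_no, csat_ex, sat_neg,
    sat_ev, tIn, tOut, sat_atom, modI_in, modI_out]
  obtain ⟨y, hy⟩ := out_of_dec H (j := j) h
  refine ⟨⟨y, Or.inl ⟨j, rfl, hy⟩, Or.inl (Or.inl ⟨j, rfl, hy⟩), ?_⟩, ?_⟩
  · have h1 := hy.1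
    rintro (⟨h2, _⟩ | ⟨u, hu, -, rfl, _⟩)
    · exact h1.ne' (hf.injective h2)
    · have := hf.lt_iff_lt.1 hu
      omega
  · rintro b ⟨h1, h2⟩
    cases hf.injective h1
    omega

theorem ms_zero (hf : StrictMono f) {i j x : ℕ} (H : Hist fun l => c l i)
    (h : c j i = 0) : MS q f e st c (f j) x (zeroF i) := by
  simp only [MS, zeroF, cur, sat_and, csat_no, sat_neg,
    sat_ev, tIn, tOut, sat_atom, modI_in, modI_out]
  rintro b ⟨h1, h2⟩
  have hlt : c b i < c (b + 1) i → b < j := by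
    intro h3
    by_contra! hb
    have h4 := H.up b
    rcases Nat.eq_or_lt_of_le hb with rfl | hb
    · exact h2 (Or.inl ⟨rfl, by omega⟩)
    · exact h2 (Or.inr ⟨f b, hf hb, Set.mem_univ _, rfl, by omega⟩)
  have hA : ∀ k, j ≤ k → OutAt (fun l => c l i) b k → False := by
    intro k hk ho
    have h3 := hlt (ho.2.2 (b + 1) (by omega) ho.1)
    have h4 : c b i < c j i := ho.2.2 j h3 hk
    omega
  have hB : (∀ l, b < l → c b i < c l i) → False := by
    intro ho
    have h3 := hlt (ho (b + 1) (by omega))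
    have h4 := ho j h3
    omega
  rcases h1 with (⟨k, h3, ho⟩ | ⟨_, ho⟩) | ⟨u, hu, -, ⟨k, rfl, ho⟩ | ⟨_, ho⟩⟩
  · exact hA k (hf.injective h3).le ho
  · exact hB ho
  · exact hA k (hf.lt_iff_lt.1 hu).le ho
  · exact hB ho

theorem ms_nx (hf : StrictMono f) {j : ℕ} {φ : TForm}
    (h : MS q f e st c (f (j + 1)) (j + 1) φ) : MS q f e st c (f j) j (nx φ) := by
  simp only [MS, nx, sat_exNe, sat_and, sat_neg, sat_diaF, tS, tK, sat_atom]
  refine ⟨j + 1, Set.mem_univ _, by omega, ⟨f (j + 1), hf (by omega), Set.mem_univ _, rfl, h⟩, ?_⟩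
  rintro ⟨t', h1, -, ⟨k, rfl⟩, u, h2, -, h3⟩
  have h3 : u = f (j + 1) := h3
  subst h3
  have := hf.lt_iff_lt.1 h1
  have := hf.lt_iff_lt.1 h2
  omega

theorem ms_only (hf : StrictMono f) (he : ∀ k, f k < e) {m i j x : ℕ} {φ : TForm}
    (h : ∀ k, k ≠ i → c (j + 1) k = c j k) (hφ : MS q f e st c (f j) x φ) :
    MS q f e st c (f j) x (only m i φ) := by
  rw [MS, sat_only]
  exact fun k _ => ⟨fun _ => hφ, fun hk => ms_idle hf he (h k hk)⟩

theorem ms_allIdle (hf : StrictMono f) (he : ∀ k, f k < e) {m j x : ℕ}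
    (h : ∀ k, c (j + 1) k = c j k) : MS q f e st c (f j) x (allIdle m) := by
  rw [MS, sat_allIdle]
  exact fun k _ => ms_idle hf he (h k)

theorem ms_q {j : ℕ} {s : σ} (h : st j = some s) : MS q f e st c (f j) j (tQ (q s)) :=
  modI_q.2 ⟨rfl, s, h, rfl⟩

theorem complete_aux (hq : Function.Injective q) (ins : σ → Ins σ) (L : List σ) (m : ℕ) (s0 : σ)
    (n : ℕ) (hf : StrictMono f) (he : ∀ k, f k < e) {r : T} (hr : r < f 0)
    (H : ∀ i, Hist fun l => c l i)
    (hpre : ∀ j, st j = none → c (j + 1) 0 = c j 0 + 1 ∧ ∀ k, k ≠ 0 → c (j + 1) k = c j k)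
    (hlt : ∀ j, j < n → st j = none) (hn : st n = some s0)
    (hstep : ∀ j s, st j = some s → ∃ s', st (j + 1) = some s' ∧
      mstep ins (s, c j) = some (s', c (j + 1))) :
    FOLTLConstSat (fun a b : T => a < b) (mainF q ins L m s0 n) := by
  refine ⟨ℕ, modI q f e st c, r, 0, ?_⟩
  have hax : ∀ t x, MS q f e st c t x (ax q ins L m) := by
    intro t x
    simp only [ax, MS, sat_and, sat_timp]
    refine ⟨⟨?_, ?_, ?_⟩, ?_, ?_⟩
    · rintro hk ⟨y, _, _, h⟩
      exact h hk
    · intro h; exact ⟨x, h⟩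
    · rintro ⟨rfl, h⟩
      obtain ⟨h1, h2⟩ := hpre x h
      exact ms_only hf he h2 (ms_inc hf he h1)
    · rw [sat_conj]
      intro φ hφ
      obtain ⟨i, _, rfl⟩ := List.mem_map.1 hφ
      exact ms_axC hf he (H i) t x
    · rw [sat_conj]
      intro φ hφ
      obtain ⟨s, _, rfl⟩ := List.mem_map.1 hφ
      rw [sat_timp]
      intro h1
      obtain ⟨rfl, s', hs', hqs⟩ := modI_q.1 h1
      cases hq hqs
      obtain ⟨s'', hs'', hm⟩ := hstep x _ hs'
      cases hi : ins s with
      | halt => simp [mstep, hi] at hm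
      | inc k s1 =>
        simp only [mstep, hi, Option.some.injEq, Prod.mk.injEq] at hm
        obtain ⟨rfl, hm⟩ := hm
        refine ⟨ms_only hf he ?_ (ms_inc hf he ?_), ms_nx hf (ms_q hs'')⟩
        · intro k' hk; rw [← hm]; simp [hk]
        · rw [← hm]; simp
      | jmp s1 =>
        simp only [mstep, hi, Option.some.injEq, Prod.mk.injEq] at hm
        obtain ⟨rfl, hm⟩ := hm
        exact ⟨ms_allIdle hf he fun k => by rw [hm], ms_nx hf (ms_q hs'')⟩
      | jz k s1 s2 =>
        simp only [insF, sat_tor]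
        by_cases h0 : c x k = 0
        · simp only [mstep, hi, h0, if_true, Option.some.injEq, Prod.mk.injEq] at hm
          obtain ⟨rfl, hm⟩ := hm
          exact Or.inl ⟨⟨ms_zero hf (H k) h0, ms_allIdle hf he fun k => by rw [hm]⟩,
            ms_nx hf (ms_q hs'')⟩
        · simp only [mstep, hi, h0, if_false, Option.some.injEq, Prod.mk.injEq] at hm
          obtain ⟨rfl, hm⟩ := hm
          refine Or.inr ⟨ms_only hf he ?_ (ms_dec hf he (H k) ?_), ms_nx hf (ms_q hs'')⟩
          · intro k' hk; rw [← hm]; simp [hk]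
          · rw [← hm]; simp; omega
  have hth : ∀ k j, j + k = n → MS q f e st c (f j) j (theta (q s0) k) := by
    intro k
    induction k with
    | zero =>
      intro j hj
      have : j = n := by omega
      subst this
      exact ms_q hn
    | succ k ih =>
      intro j hj
      exact ⟨⟨rfl, hlt j (by omega)⟩, ms_nx hf (ih (j + 1) (by omega))⟩
  simp only [mainF, sat_and, csat_no, sat_neg, not_not, sat_box]
  refine ⟨fun b t _ _ => hax t b, f 0, hr, Set.mem_univ _, ⟨⟨0, rfl⟩, ?_⟩, hth n 0 (by omega)⟩
  rw [sat_conj]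
  intro φ hφ
  obtain ⟨i, _, rfl⟩ := List.mem_map.1 hφ
  exact ms_zero hf (H i) (H i).zero

theorem mstep_le {ins : σ → Ins σ} {s s' : σ} {c c' : ℕ → ℕ}
    (h1 : mstep ins (s, c) = some (s', c')) (i : ℕ) : c' i ≤ c i + 1 ∧ c i ≤ c' i + 1 := by
  simp only [mstep] at h1
  cases hi : ins s with
  | halt => simp [hi] at h1
  | inc k s1 =>
    simp only [hi, Option.some.injEq, Prod.mk.injEq] at h1
    rw [← h1.2]
    by_cases hk : i = k
    · subst hk; simp; omega
    · simp [hk]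
  | jmp s1 =>
    simp only [hi, Option.some.injEq, Prod.mk.injEq] at h1
    rw [← h1.2]; simp
  | jz k s1 s2 =>
    simp only [hi] at h1
    split_ifs at h1 with hc
    · simp only [Option.some.injEq, Prod.mk.injEq] at h1
      rw [← h1.2]; simp
    · simp only [Option.some.injEq, Prod.mk.injEq] at h1
      rw [← h1.2]
      by_cases hk : i = k
      · subst hk; simp; omega
      · simp [hk]

theorem complete (hq : Function.Injective q) (ins : σ → Ins σ) (L : List σ) (m : ℕ) (s0 : σ)
    (n : ℕ) (hf : StrictMono f) (he : ∀ k, f k < e) {r : T} (hr : r < f 0)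
    (h : ¬ Acc (fun c' c => mstep ins c = some c') (s0, Function.update (fun _ => 0) 0 n)) :
    FOLTLConstSat (fun a b : T => a < b) (mainF q ins L m s0 n) := by
  rw [not_acc_iff_exists_descending_chain] at h
  obtain ⟨ρ, h0, hρ⟩ := h
  have hst : ∀ k i, (ρ (k + 1)).2 i ≤ (ρ k).2 i + 1 ∧ (ρ k).2 i ≤ (ρ (k + 1)).2 i + 1 :=
    fun k i => mstep_le (hρ k) i
  refine complete_aux (e := e) (st := fun j => if j < n then none else some (ρ (j - n)).1)
    (c := fun j i => if j < n then (if i = 0 then j else 0) else (ρ (j - n)).2 i)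
    hq ins L m s0 n hf he hr ?_ ?_ ?_ ?_ ?_
  · intro i
    have hj : ∀ j, (j + 1 < n ∧ j < n) ∨ (n = j + 1) ∨
        (¬ j + 1 < n ∧ ¬ j < n ∧ j + 1 - n = (j - n) + 1) := by intro j; omega
    have hz : (ρ 0).2 i = if i = 0 then n else 0 := by
      rw [h0]; by_cases hi : i = 0 <;> simp [hi]
    refine ⟨?_, fun j => ?_, fun j => ?_⟩
    · rcases Nat.eq_zero_or_pos n with rfl | hn
      · simp only [lt_irrefl, if_false, Nat.sub_zero]
        rw [hz]; simp
      · simp [hn]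
    · rcases hj j with ⟨h1, h2⟩ | rfl | ⟨h1, h2, h3⟩
      · simp only [h1, h2, if_true]; split_ifs <;> omega
      · simp only [lt_irrefl, if_false, Nat.sub_self, hz, Nat.lt_succ_self, if_true]
        split_ifs <;> omega
      · simp only [h1, h2, if_false, h3]; exact (hst _ i).1
    · rcases hj j with ⟨h1, h2⟩ | rfl | ⟨h1, h2, h3⟩
      · simp only [h1, h2, if_true]; split_ifs <;> omega
      · simp only [lt_irrefl, if_false, Nat.sub_self, hz, Nat.lt_succ_self, if_true]
        split_ifs <;> omega
      · simp only [h1, h2, if_false, h3]; exact (hst _ i).2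
  · intro j hj
    have hj : j < n := by by_contra hc; simp [hc] at hj
    by_cases h1 : j + 1 < n
    · simp only [h1, hj, if_true]
      exact ⟨trivial, fun k hk => by simp [hk]⟩
    · have : n = j + 1 := by omega
      subst this
      simp only [lt_irrefl, if_false, Nat.sub_self, Nat.lt_succ_self, if_true, h0]
      exact ⟨by simp, fun k hk => by simp [hk]⟩
  · intro j hj; simp [hj]
  · simp [h0]
  · intro j s hj
    have hjn : ¬ j < n := by intro hc; simp [hc] at hj
    have h1 : ¬ j + 1 < n := by omega
    have h2 : j + 1 - n = (j - n) + 1 := by omega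
    simp only [hjn, if_false, Option.some.injEq] at hj
    subst hj
    simp only [hjn, h1, if_false, h2]
    exact ⟨_, rfl, hρ _⟩

end completeness

/-! ## Assembling the reduction -/

theorem encodeT_inj : ∀ φ ψ : TForm, encodeT φ = encodeT ψ → φ = ψ := by
  intro φ
  induction φ with
  | atom n => intro ψ h; cases ψ <;> simp_all [encodeT]
  | neg φ ih => intro ψ h; cases ψ <;> simp [encodeT] at h ⊢; exact ih _ h
  | and φ χ ih1 ih2 =>
    intro ψ h; cases ψ <;> simp [encodeT] at h ⊢; exact ⟨ih1 _ h.1, ih2 _ h.2⟩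
  | diaF φ ih => intro ψ h; cases ψ <;> simp [encodeT] at h ⊢; exact ih _ h
  | exNe φ ih => intro ψ h; cases ψ <;> simp [encodeT] at h ⊢; exact ih _ h

theorem tcodes_encode (P : TForm → Prop) (φ : TForm) : TCodes P (encodeT φ) ↔ P φ := by
  constructor
  · rintro ⟨ψ, h, hp⟩
    rwa [← encodeT_inj _ _ h]
  · intro h; exact ⟨φ, rfl, h⟩

theorem primrec_pairc (a : ℕ) : Primrec fun n : ℕ => Nat.pair a n :=
  Primrec₂.natPair.comp (Primrec.const a) Primrec.id

/-- Effect of one step of `theta` on codes. -/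
def thetaStep (y : ℕ) : ℕ :=
  Nat.pair 2 (Nat.pair (encodeT TForm.tI) (Nat.pair 4 (Nat.pair 2 (Nat.pair
    (Nat.pair 3 (Nat.pair 2 (Nat.pair (encodeT TForm.tS) y)))
    (encodeT (TForm.neg (TForm.diaF (TForm.and TForm.tK (TForm.diaF TForm.tS)))))))))

theorem primrec_thetaStep : Primrec thetaStep := by
  have h1 : Primrec fun y : ℕ => Nat.pair 3 (Nat.pair 2 (Nat.pair (encodeT TForm.tS) y)) :=
    (primrec_pairc _).comp ((primrec_pairc _).comp (primrec_pairc _))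
  exact (primrec_pairc _).comp ((primrec_pairc _).comp ((primrec_pairc _).comp
    ((primrec_pairc _).comp (Primrec₂.natPair.comp h1 (Primrec.const _)))))

theorem encode_theta (j n : ℕ) :
    encodeT (TForm.theta j n) = thetaStep^[n] (encodeT (TForm.tQ j)) := by
  induction n with
  | zero => rfl
  | succ n ih =>
    rw [Function.iterate_succ_apply', ← ih]
    rfl

theorem primrec_main {σ : Type} (q : σ → ℕ) (ins : σ → Ins σ) (L : List σ) (m : ℕ) (s0 : σ) :
    Primrec fun n => encodeT (TForm.mainF q ins L m s0 n) := by
  have h1 : Primrec fun n : ℕ => encodeT (TForm.theta (q s0) n) := by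
    simp only [encode_theta]
    exact Primrec.nat_iterate Primrec.id (Primrec.const _) (primrec_thetaStep.comp Primrec.snd).to₂
  exact (primrec_pairc 2).comp ((primrec_pairc _).comp ((primrec_pairc 3).comp
    ((primrec_pairc 2).comp ((primrec_pairc _).comp h1))))

theorem const_dec {T : Type} {lt : T → T → Prop} {φ : TForm} (h : FOLTLConstSat lt φ) :
    FOLTLDecSat lt φ := by
  obtain ⟨U, I, t, a, h⟩ := h
  exact ⟨U, fun _ => Set.univ, fun _ => ⟨a, Set.mem_univ _⟩, fun _ _ _ => subset_rfl, I, t, a,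
    Set.mem_univ _, h⟩

theorem undec {T : Type} [LinearOrder T] (f : ℕ → T) (e r : T) (hf : StrictMono f)
    (he : ∀ k, f k < e) (hr : r < f 0) :
    ¬ ComputablePred (TCodes (fun φ => FOLTLDecSat (fun a b : T => a < b) φ)) ∧
    ¬ ComputablePred (TCodes (fun φ => FOLTLConstSat (fun a b : T => a < b) φ)) := by
  obtain ⟨P, hP⟩ := exists_undecidable_prog
  let F : ℕ → TForm := TForm.mainF Prog.lcode Prog.ins ([] :: P.states []) (max 1 P.bound) [P]
  have hF : Computable fun n => encodeT (F n) := (primrec_main _ _ _ _ _).to_comp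
  have h1 : ∀ n, ¬ PAcc ([P], Function.update (fun _ => 0) 0 n) →
      FOLTLConstSat (fun a b : T => a < b) (F n) := fun n h =>
    complete Prog.lcode_inj _ _ _ _ _ hf he hr h
  have h2 : ∀ n, FOLTLDecSat (fun a b : T => a < b) (F n) →
      ¬ PAcc ([P], Function.update (fun _ => 0) 0 n) := fun n h => by
    refine sound _ _ _ _ _ _ (by simp) ?_ (List.mem_cons_of_mem _ (P.mem_states [])) h
    intro s hs
    rcases List.mem_cons.1 hs with rfl | hs
    · simp [Prog.ins, InsOk]
    · exact (P.states_ok [] s hs).mono (List.Subset.refl _) (le_max_right _ _)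
  constructor
  · intro hc
    refine hP (ComputablePred.computable_of_manyOneReducible ⟨_, hF, fun n => ?_⟩ hc)
    rw [tcodes_encode]
    exact ⟨fun h => const_dec (h1 n h), h2 n⟩
  · intro hc
    refine hP (ComputablePred.computable_of_manyOneReducible ⟨_, hF, fun n => ?_⟩ hc)
    rw [tcodes_encode]
    exact ⟨h1 n, fun h => h2 n (const_dec h)⟩

theorem undec_field {T : Type} [Field T] [LinearOrder T] [IsStrictOrderedRing T] :
    ¬ ComputablePred (TCodes (fun φ => FOLTLDecSat (fun a b : T => a < b) φ)) ∧
    ¬ ComputablePred (TCodes (fun φ => FOLTLConstSat (fun a b : T => a < b) φ)) := by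
  refine undec (fun k : ℕ => -(1 / ((k : T) + 1))) 0 (-2) ?_ ?_ ?_
  · refine strictMono_nat_of_lt_succ fun k => neg_lt_neg ?_
    exact one_div_lt_one_div_of_lt (by positivity) (by push_cast; linarith)
  · intro k
    have : (0 : T) < 1 / ((k : T) + 1) := by positivity
    linarith
  · norm_num

/-- FOLTL≠-satisfiability is undecidable in decreasing and in
constant domain models over `⟨ℚ,<⟩`, and likewise over `⟨ℝ,<⟩`. -/
theorem foltl_rationals_reals_undecidable :
    (¬ ComputablePred (TCodes (fun φ => FOLTLDecSat (fun a b : ℚ => a < b) φ)) ∧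
     ¬ ComputablePred (TCodes (fun φ => FOLTLConstSat (fun a b : ℚ => a < b) φ))) ∧
    (¬ ComputablePred (TCodes (fun φ => FOLTLDecSat (fun a b : ℝ => a < b) φ)) ∧
     ¬ ComputablePred (TCodes (fun φ => FOLTLConstSat (fun a b : ℝ => a < b) φ))) := by
  exact ⟨undec_field, undec_field⟩

end HK
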